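/- (Theorem 3.4) Assume Ideal[c_E] + QM[c_I] is Archimedean, K is nonempty, and f_mom equals the γ-program value f_γ, with the infimum defining f_γ attained at a real vector (γ̂_1,…,γ̂_m). Then the moment relaxation values converge: f_mom,k → f_mom as k → ∞; more precisely, for every ε > 0 there exists N such that f_mom ≤ f_mom,k ≤ f_mom + mε for all k ≥ N. -/

import Mathlib

open MvPolynomial Finset Filter Topology

noncomputable section

/-- Extended-real logarithm with the convention `log t = -∞` for `t ≤ 0`. -/
def elog (t : ℝ) : EReal := if 0 < t then ((Real.log t : ℝ) : EReal) else ⊥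

/-- The degree `|α|` of a multi-index `α`. -/
def mdeg {n : ℕ} (α : Fin n →₀ ℕ) : ℕ := ∑ i, α i

/-- The monomial vector `[x]_{2d}`, modeled as the function on multi-indices
whose `α`-entry is `x^α` for `|α| ≤ 2d` (and `0` above the truncation degree). -/
def monoVec {n : ℕ} (d : ℕ) (x : Fin n → ℝ) : (Fin n →₀ ℕ) → ℝ :=
  fun α => if mdeg α ≤ 2 * d then ∏ i, x i ^ α i else 0

/-- The pairing `⟨p, z⟩ = ∑_α p_α z_α`. -/
def pairing {n : ℕ} (p : MvPolynomial (Fin n) ℝ) (z : (Fin n →₀ ℕ) → ℝ) : ℝ :=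
  ∑ α ∈ p.support, p.coeff α * z α

/-- The moment cone `R_d(S)`. -/
def momentCone {n : ℕ} (d : ℕ) (S : Set (Fin n → ℝ)) : Set ((Fin n →₀ ℕ) → ℝ) :=
  {z | ∃ (l : ℕ) (lam : Fin l → ℝ) (v : Fin l → (Fin n → ℝ)),
    (∀ j, 0 ≤ lam j) ∧ (∀ j, v j ∈ S) ∧ z = ∑ j, lam j • monoVec d (v j)}

/-- `⌈t/2⌉` for a natural number `t`. -/
def ceilHalf (t : ℕ) : ℕ := (t + 1) / 2

/-- The objective `f(x) = ∑ᵢ aᵢ log pᵢ(x)` (with `log 0 = -∞`). -/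
def fObj {n m : ℕ} (a : Fin m → ℝ) (p : Fin m → MvPolynomial (Fin n) ℝ)
    (x : Fin n → ℝ) : EReal :=
  ∑ i, (a i : EReal) * elog (eval x (p i))

/-- `f_max`, the optimal value of the log-polynomial optimization problem. -/
def fMax {n m : ℕ} (a : Fin m → ℝ) (p : Fin m → MvPolynomial (Fin n) ℝ)
    (K : Set (Fin n → ℝ)) : EReal :=
  sSup (fObj a p '' K)

/-- The moment objective `∑ᵢ aᵢ log ⟨pᵢ, z⟩`. -/
def objVal {n m : ℕ} (a : Fin m → ℝ) (p : Fin m → MvPolynomial (Fin n) ℝ)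
    (z : (Fin n →₀ ℕ) → ℝ) : EReal :=
  ∑ i, (a i : EReal) * elog (pairing (p i) z)

/-- `f_mom`, the optimal value of the convex relaxation over `R_d(S) ∩ {z₀ = 1}`. -/
def fMom {n m : ℕ} (d : ℕ) (a : Fin m → ℝ) (p : Fin m → MvPolynomial (Fin n) ℝ)
    (S : Set (Fin n → ℝ)) : EReal :=
  sSup (objVal a p '' {z ∈ momentCone d S | z 0 = 1})

/-- `M_k[y] ⪰ 0`, encoded via quadratic forms whose coefficient vectors are
coefficient vectors of polynomials of degree at most `k`. -/
def momMatPSD {n : ℕ} (k : ℕ) (y : (Fin n →₀ ℕ) → ℝ) : Prop :=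
  ∀ q : MvPolynomial (Fin n) ℝ, q.totalDegree ≤ k →
    0 ≤ ∑ α ∈ q.support, ∑ β ∈ q.support, q.coeff α * q.coeff β * y (α + β)

/-- The `(α,β)` entry of the localizing matrix `L_c^{(k)}[y]`. -/
def locEntry {n : ℕ} (c : MvPolynomial (Fin n) ℝ) (y : (Fin n →₀ ℕ) → ℝ)
    (α β : Fin n →₀ ℕ) : ℝ :=
  ∑ γ ∈ c.support, c.coeff γ * y (γ + α + β)

/-- `L_c^{(k)}[y] = 0`. -/
def locMatZero {n : ℕ} (c : MvPolynomial (Fin n) ℝ) (k : ℕ)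
    (y : (Fin n →₀ ℕ) → ℝ) : Prop :=
  ∀ α β : Fin n →₀ ℕ, mdeg α ≤ k - ceilHalf c.totalDegree →
    mdeg β ≤ k - ceilHalf c.totalDegree → locEntry c y α β = 0

/-- `L_c^{(k)}[y] ⪰ 0`. -/
def locMatPSD {n : ℕ} (c : MvPolynomial (Fin n) ℝ) (k : ℕ)
    (y : (Fin n →₀ ℕ) → ℝ) : Prop :=
  ∀ q : MvPolynomial (Fin n) ℝ, q.totalDegree ≤ k - ceilHalf c.totalDegree →
    0 ≤ ∑ α ∈ q.support, ∑ β ∈ q.support, q.coeff α * q.coeff β * locEntry c y α β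

/-- Feasibility for the `k`-th order moment relaxation with equality constraint
polynomials `Eqs` and inequality constraint polynomials `Ineqs`. -/
def momFeasible {n : ℕ} (Eqs Ineqs : Set (MvPolynomial (Fin n) ℝ)) (k : ℕ)
    (y : (Fin n →₀ ℕ) → ℝ) : Prop :=
  y 0 = 1 ∧ momMatPSD k y ∧ (∀ c ∈ Eqs, locMatZero c k y) ∧ ∀ c ∈ Ineqs, locMatPSD c k y

/-- `f_mom,k`, the optimal value of the `k`-th order moment relaxation. -/
def fMomK {n m : ℕ} (a : Fin m → ℝ) (p : Fin m → MvPolynomial (Fin n) ℝ)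
    (Eqs Ineqs : Set (MvPolynomial (Fin n) ℝ)) (k : ℕ) : EReal :=
  sSup (objVal a p '' {y | momFeasible Eqs Ineqs k y})

/-- The value `f_γ` of the γ-program. -/
def fGamma {n m : ℕ} (a : Fin m → ℝ) (p : Fin m → MvPolynomial (Fin n) ℝ)
    (K : Set (Fin n → ℝ)) : EReal :=
  sInf {e : EReal | ∃ γ : Fin m → ℝ,
    (∀ i, ∀ x ∈ K, (a i : EReal) * elog (eval x (p i)) ≤ ((γ i : ℝ) : EReal)) ∧
    e = ((∑ i, γ i : ℝ) : EReal)}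

/-- A polynomial is a sum of squares. -/
def IsSOSPoly {n : ℕ} (σ : MvPolynomial (Fin n) ℝ) : Prop :=
  ∃ (t : ℕ) (r : Fin t → MvPolynomial (Fin n) ℝ), σ = ∑ j, (r j) ^ 2

/-- The set `Ideal[c_E] + QM[c_I]`. -/
def idealQM {n : ℕ} {ι : Type*} (E I : Finset ι) (c : ι → MvPolynomial (Fin n) ℝ) :
    Set (MvPolynomial (Fin n) ℝ) :=
  {q | ∃ (h : ι → MvPolynomial (Fin n) ℝ) (σ0 : MvPolynomial (Fin n) ℝ)
      (σ : ι → MvPolynomial (Fin n) ℝ),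
    IsSOSPoly σ0 ∧ (∀ j ∈ I, IsSOSPoly (σ j)) ∧
    q = (∑ j ∈ E, h j * c j) + σ0 + ∑ j ∈ I, σ j * c j}

/-- A set closed under addition and multiplication that contains all squares. -/
structure IsPreord {B : Type*} [CommRing B] (T : Set B) : Prop where
  add_mem : ∀ {s t}, s ∈ T → t ∈ T → s + t ∈ T
  mul_mem : ∀ {s t}, s ∈ T → t ∈ T → s * t ∈ T
  sq_mem : ∀ s, s ^ 2 ∈ T

/-- A set containing `1`, closed under addition and under multiplication by elements of `T`. -/
structure IsConeModule {B : Type*} [CommRing B] (T M : Set B) : Prop where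
  one_mem : 1 ∈ M
  add_mem : ∀ {a b}, a ∈ M → b ∈ M → a + b ∈ M
  mul_mem : ∀ {t a}, t ∈ T → a ∈ M → t * a ∈ M

theorem isPreord_sumSq (B : Type*) [CommRing B] : IsPreord {s : B | IsSumSq s} where
  add_mem := IsSumSq.add
  mul_mem := IsSumSq.mul
  sq_mem s := by simp [sq]

namespace IsPreord
variable {B : Type*} [CommRing B] {T : Set B}

theorem zero_mem (hT : IsPreord T) : 0 ∈ T := by simpa using hT.sq_mem (0 : B)

theorem one_mem (hT : IsPreord T) : 1 ∈ T := by simpa using hT.sq_mem 1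

theorem isConeModule (hT : IsPreord T) : IsConeModule T T :=
  ⟨hT.one_mem, hT.add_mem, hT.mul_mem⟩

theorem real_mem [Algebra ℝ B] (hT : IsPreord T) {r : ℝ} (hr : 0 ≤ r) :
    algebraMap ℝ B r ∈ T := by
  have := hT.sq_mem (algebraMap ℝ B (Real.sqrt r))
  rwa [← map_pow, Real.sq_sqrt hr] at this

end IsPreord

namespace IsConeModule
variable {B : Type*} [CommRing B] {T M Q : Set B}

theorem subset (hM : IsConeModule T M) {t : B} (ht : t ∈ T) : t ∈ M := by
  simpa using hM.mul_mem ht hM.one_mem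

theorem zero_mem (hT : IsPreord T) (hM : IsConeModule T M) : 0 ∈ M := hM.subset hT.zero_mem

/-- Zorn: a proper module is contained in a maximal proper one. -/
theorem exists_maximal (hM : IsConeModule T M) (h : (-1 : B) ∉ M) :
    ∃ Q, M ⊆ Q ∧ Maximal (fun Q => IsConeModule T Q ∧ (-1 : B) ∉ Q) Q := by
  refine zorn_subset_nonempty {Q | IsConeModule T Q ∧ (-1 : B) ∉ Q} ?_ M ⟨hM, h⟩
  intro c hc hchain hne
  refine ⟨⋃₀ c, ⟨⟨?_, ?_, ?_⟩, ?_⟩, fun s hs => Set.subset_sUnion_of_mem hs⟩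
  · obtain ⟨s, hs⟩ := hne
    exact ⟨s, hs, (hc hs).1.one_mem⟩
  · rintro a b ⟨s, hs, ha⟩ ⟨t, ht, hb⟩
    rcases hchain.total hs ht with h | h
    · exact ⟨t, ht, (hc ht).1.add_mem (h ha) hb⟩
    · exact ⟨s, hs, (hc hs).1.add_mem ha (h hb)⟩
  · rintro t a ht ⟨s, hs, ha⟩
    exact ⟨s, hs, (hc hs).1.mul_mem ht ha⟩
  · rintro ⟨s, hs, h1⟩
    exact (hc hs).2 h1

/-- The module obtained by adjoining one element. -/
theorem adjoin (hT : IsPreord T) (hM : IsConeModule T M) (a : B) :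
    IsConeModule T {x | ∃ q ∈ M, ∃ t ∈ T, x = q + t * a} where
  one_mem := ⟨1, hM.one_mem, 0, hT.zero_mem, by ring⟩
  add_mem := by
    rintro _ _ ⟨q, hq, t, ht, rfl⟩ ⟨q', hq', t', ht', rfl⟩
    exact ⟨q + q', hM.add_mem hq hq', t + t', hT.add_mem ht ht', by ring⟩
  mul_mem := by
    rintro s _ hs ⟨q, hq, t, ht, rfl⟩
    exact ⟨s * q, hM.mul_mem hs hq, s * t, hT.mul_mem hs ht, by ring⟩

theorem neg_one_of_notMem (hT : IsPreord T)
    (hQ : Maximal (fun Q => IsConeModule T Q ∧ (-1 : B) ∉ Q) Q) {a : B} (ha : a ∉ Q) :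
    ∃ q ∈ Q, ∃ t ∈ T, -1 = q + t * a := by
  by_contra hcon
  have h0 := zero_mem hT hQ.prop.1
  have := hQ.le_of_ge (y := {x | ∃ q ∈ Q, ∃ t ∈ T, x = q + t * a})
    ⟨adjoin hT hQ.prop.1 a, hcon⟩ (fun q hq => ⟨q, hq, 0, hT.zero_mem, by ring⟩)
  exact ha (this ⟨0, h0, 1, hT.one_mem, by ring⟩)

variable [Algebra ℝ B]

theorem support_mul (hT : IsPreord T) (hM : IsConeModule T M) {x : B} (hx : x ∈ M) (hx' : -x ∈ M)
    (a : B) : a * x ∈ M := by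
  have h4 : algebraMap ℝ B (1 / 4) * 4 = 1 := by
    rw [show (4 : B) = algebraMap ℝ B 4 from (map_ofNat _ 4).symm, ← map_mul]; norm_num
  have : a * x = algebraMap ℝ B (1 / 4) * ((a + 1) ^ 2 * x + (a - 1) ^ 2 * (-x)) := by
    linear_combination (-a * x) * h4
  rw [this]
  exact hM.mul_mem (hT.real_mem (by norm_num))
    (hM.add_mem (hM.mul_mem (hT.sq_mem _) hx) (hM.mul_mem (hT.sq_mem _) hx'))

theorem mem_or_neg_mem (hT : IsPreord T)
    (hQ : Maximal (fun Q => IsConeModule T Q ∧ (-1 : B) ∉ Q) Q) (a : B) : a ∈ Q ∨ -a ∈ Q := by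
  by_contra! h
  obtain ⟨q, hq, t, ht, h1⟩ := neg_one_of_notMem hT hQ h.1
  obtain ⟨q', hq', t', ht', h2⟩ := neg_one_of_notMem hT hQ h.2
  have hm := hQ.prop.1
  have hnt : -t ∈ Q := by
    have : -t = t' + (t' * q + t * q') := by linear_combination t' * h1 + t * h2
    rw [this]
    exact hm.add_mem (hm.subset ht') (hm.add_mem (hm.mul_mem ht' hq) (hm.mul_mem ht hq'))
  have := support_mul hT hm (hm.subset ht) hnt a
  apply hQ.prop.2
  rw [h1, mul_comm t a]
  exact hm.add_mem hq this

/-- The support of a maximal proper module is prime. -/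
theorem support_prime (hT : IsPreord T)
    (hQ : Maximal (fun Q => IsConeModule T Q ∧ (-1 : B) ∉ Q) Q) {a b : B}
    (hab : a * b ∈ Q) (hab' : -(a * b) ∈ Q) : (a ∈ Q ∧ -a ∈ Q) ∨ (b ∈ Q ∧ -b ∈ Q) := by
  have hm := hQ.prop.1
  have key : ∀ a b : B, a * b ∈ Q → -(a * b) ∈ Q → a ∉ Q → -(b ^ 2) ∈ Q := by
    intro a b hab hab' ha
    obtain ⟨q, hq, t, ht, h1⟩ := neg_one_of_notMem hT hQ ha
    have : -(b ^ 2) = b ^ 2 * q + (t * b) * (a * b) := by linear_combination b ^ 2 * h1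
    rw [this]
    exact hm.add_mem (hm.mul_mem (hT.sq_mem b) hq) (support_mul hT hm hab hab' _)
  have key2 : ∀ b : B, -(b ^ 2) ∈ Q → b ∈ Q := by
    intro b hb
    by_contra hbQ
    obtain ⟨q, hq, t, ht, h1⟩ := neg_one_of_notMem hT hQ hbQ
    apply hQ.prop.2
    have : -1 = t ^ 2 * (-(b ^ 2)) + (q + q + q ^ 2) := by
      linear_combination (1 + q - t * b) * h1
    rw [this]
    exact hm.add_mem (hm.mul_mem (hT.sq_mem _) hb)
      (hm.add_mem (hm.add_mem hq hq) (hm.subset (hT.sq_mem q)))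
  have key3 : ∀ a b : B, a * b ∈ Q → -(a * b) ∈ Q → a ∉ Q → b ∈ Q ∧ -b ∈ Q := by
    intro a b h h' ha
    have := key a b h h' ha
    exact ⟨key2 b this, key2 (-b) (by simpa using this)⟩
  by_cases ha : a ∈ Q
  · by_cases ha' : -a ∈ Q
    · exact Or.inl ⟨ha, ha'⟩
    · exact Or.inr (key3 (-a) b (by simpa using hab') (by simpa using hab) ha')
  · exact Or.inr (key3 a b hab hab' ha)

end IsConeModule

section Place
variable {A : Type*} [CommRing A] [Algebra ℝ A]

/-- `r` is the standard part of `f` relative to `Q`. -/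
def IsStdPart (Q : Set A) (f : A) (r : ℝ) : Prop :=
  ∀ ε : ℝ, 0 < ε → algebraMap ℝ A (ε - r) + f ∈ Q ∧ algebraMap ℝ A (ε + r) - f ∈ Q

variable {T Q : Set A}

namespace IsStdPart

theorem unique (hT : IsPreord T) (hQ : IsConeModule T Q) (h1 : (-1 : A) ∉ Q) {f : A} {r s : ℝ}
    (hr : IsStdPart Q f r) (hs : IsStdPart Q f s) : r = s := by
  have key : ∀ r s : ℝ, IsStdPart Q f r → IsStdPart Q f s → ¬ r < s := by
    intro r s hr hs hlt
    have h := hQ.add_mem (hs ((s - r) / 4) (by linarith)).1 (hr ((s - r) / 4) (by linarith)).2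
    have h' := hQ.mul_mem (hT.real_mem (r := 2 / (s - r)) (div_nonneg (by norm_num) (by linarith))) h
    apply h1
    convert h' using 1
    rw [show algebraMap ℝ A ((s - r) / 4 - s) + f + (algebraMap ℝ A ((s - r) / 4 + r) - f)
      = algebraMap ℝ A ((s - r) / 4 - s + ((s - r) / 4 + r)) by rw [map_add _ (_ - _)]; ring,
      ← map_mul, ← map_one (algebraMap ℝ A), ← map_neg]
    congr 1
    have : s - r ≠ 0 := by linarith
    field_simp
    ring
  exact le_antisymm (not_lt.1 (key _ _ hs hr)) (not_lt.1 (key _ _ hr hs))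

theorem add (hQ : IsConeModule T Q) {f g : A} {r s : ℝ}
    (hr : IsStdPart Q f r) (hs : IsStdPart Q g s) : IsStdPart Q (f + g) (r + s) := by
  intro ε hε
  have h1 := hr (ε / 2) (by linarith)
  have h2 := hs (ε / 2) (by linarith)
  constructor
  · convert hQ.add_mem h1.1 h2.1 using 1
    rw [show ε - (r + s) = (ε / 2 - r) + (ε / 2 - s) by ring, map_add]; ring
  · convert hQ.add_mem h1.2 h2.2 using 1
    rw [show ε + (r + s) = (ε / 2 + r) + (ε / 2 + s) by ring, map_add]; ring

theorem const (hT : IsPreord T) (hQ : IsConeModule T Q) (c : ℝ) :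
    IsStdPart Q (algebraMap ℝ A c) c := by
  intro ε hε
  rw [← map_add, ← map_sub]
  exact ⟨hQ.subset (hT.real_mem (by linarith)), hQ.subset (hT.real_mem (by linarith))⟩

theorem neg {f : A} {r : ℝ} (hr : IsStdPart Q f r) : IsStdPart Q (-f) (-r) := by
  intro ε hε
  have := hr ε hε
  exact ⟨by simpa [sub_eq_add_neg] using this.2, by simpa [sub_eq_add_neg] using this.1⟩

theorem smul (hT : IsPreord T) (hQ : IsConeModule T Q) {f : A} {r : ℝ} (c : ℝ)
    (hr : IsStdPart Q f r) : IsStdPart Q (algebraMap ℝ A c * f) (c * r) := by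
  have key : ∀ c : ℝ, 0 < c → IsStdPart Q (algebraMap ℝ A c * f) (c * r) := by
    intro c hc ε hε
    have := hr (ε / c) (by positivity)
    have hc' := hT.real_mem hc.le
    constructor
    · convert hQ.mul_mem hc' this.1 using 1
      rw [mul_add, ← map_mul]; congr 2; field_simp
    · convert hQ.mul_mem hc' this.2 using 1
      rw [mul_sub, ← map_mul]; congr 2; field_simp
  rcases lt_trichotomy c 0 with hc | rfl | hc
  · have := (key (-c) (by linarith)).neg
    simpa using this
  · simpa using const hT hQ 0
  · exact key c hc

theorem sq_zero (hT : IsPreord T) (hQ : IsConeModule T Q) {f : A} (hr : IsStdPart Q f 0) :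
    IsStdPart Q (f ^ 2) 0 := by
  intro ε hε
  constructor
  · rw [sub_zero]
    exact hQ.add_mem (hQ.subset (hT.real_mem hε.le)) (hQ.subset (hT.sq_mem f))
  · rw [add_zero]
    have hs := Real.sqrt_pos.2 hε
    obtain ⟨h1, h2⟩ := hr _ hs
    rw [sub_zero] at h1
    rw [add_zero] at h2
    set e := algebraMap ℝ A (Real.sqrt ε) with he
    have h3 := hQ.add_mem (hQ.mul_mem (hT.sq_mem (e - f)) h1) (hQ.mul_mem (hT.sq_mem (e + f)) h2)
    have h4 := hQ.mul_mem (hT.real_mem (r := 1 / (2 * Real.sqrt ε)) (by positivity)) h3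
    convert h4 using 1
    have hee : e ^ 2 = algebraMap ℝ A ε := by rw [he, ← map_pow, Real.sq_sqrt hε.le]
    have h5 : algebraMap ℝ A (1 / (2 * Real.sqrt ε)) * (2 * e) = 1 := by
      rw [he, show (2 : A) = algebraMap ℝ A 2 from (map_ofNat _ 2).symm, ← map_mul, ← map_mul,
        ← map_one (algebraMap ℝ A)]
      congr 1; field_simp
    rw [← hee]
    linear_combination (-(e ^ 2 - f ^ 2)) * h5

theorem sq (hT : IsPreord T) (hQ : IsConeModule T Q) {f : A} {r : ℝ} (hr : IsStdPart Q f r) :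
    IsStdPart Q (f ^ 2) (r ^ 2) := by
  have h0 : IsStdPart Q (f + algebraMap ℝ A (-r)) 0 := by
    simpa using hr.add hQ (const hT hQ (-r))
  have h1 := ((h0.sq_zero hT hQ).add hQ (hr.smul hT hQ (2 * r))).add hQ (const hT hQ (-(r ^ 2)))
  convert h1 using 1
  · simp only [map_neg, map_mul, map_pow, map_ofNat]; ring
  · ring

theorem mul (hT : IsPreord T) (hQ : IsConeModule T Q) {f g : A} {r s : ℝ}
    (hr : IsStdPart Q f r) (hs : IsStdPart Q g s) : IsStdPart Q (f * g) (r * s) := by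
  have h := ((((hr.add hQ hs).sq hT hQ).add hQ (hr.sq hT hQ).neg).add hQ
    (hs.sq hT hQ).neg).smul hT hQ (1 / 2)
  have h2 : algebraMap ℝ A (1 / 2) * 2 = 1 := by
    rw [show (2 : A) = algebraMap ℝ A 2 from (map_ofNat _ 2).symm, ← map_mul]; norm_num
  convert h using 1
  · linear_combination (-f * g) * h2
  · ring

theorem nonneg (hT : IsPreord T) (hQ : IsConeModule T Q) (h1 : (-1 : A) ∉ Q) {f : A} {r : ℝ}
    (hr : IsStdPart Q f r) (hf : f ∈ Q) : 0 ≤ r := by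
  by_contra! hlt
  have h := hQ.add_mem (hr (-r / 2) (by linarith)).2 hf
  have h' := hQ.mul_mem (hT.real_mem (r := 2 / (-r)) (div_nonneg (by norm_num) (by linarith))) h
  apply h1
  convert h' using 1
  rw [sub_add_cancel, ← map_mul, ← map_one (algebraMap ℝ A), ← map_neg]
  congr 1
  have : r ≠ 0 := hlt.ne
  field_simp
  ring

theorem exists_of_archimedean (hT : IsPreord T) (hQ : IsConeModule T Q) (h1 : (-1 : A) ∉ Q)
    (htot : ∀ a, a ∈ Q ∨ -a ∈ Q) (harch : ∀ f : A, ∃ N : ℝ, algebraMap ℝ A N - f ∈ Q) (f : A) :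
    ∃ r, IsStdPart Q f r := by
  set S : Set ℝ := {r | algebraMap ℝ A r - f ∈ Q} with hS
  have hmono : ∀ {r s : ℝ}, r ∈ S → r ≤ s → s ∈ S := by
    intro r s hr hrs
    have := hQ.add_mem hr (hQ.subset (hT.real_mem (sub_nonneg.2 hrs)))
    simpa [hS, sub_add_eq_add_sub] using this
  obtain ⟨N, hN⟩ := harch f
  obtain ⟨N', hN'⟩ := harch (-f)
  have hbdd : BddBelow S := by
    refine ⟨-N' - 1, fun r hr => ?_⟩
    by_contra! hlt
    have h := hQ.add_mem (hQ.add_mem hN' hr)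
      (hQ.subset (hT.real_mem (r := -1 - N' - r) (by linarith)))
    apply h1
    convert h using 1
    simp only [map_sub, map_neg, map_one]; ring
  refine ⟨sInf S, fun ε hε => ⟨?_, ?_⟩⟩
  · rcases htot (algebraMap ℝ A (ε - sInf S) + f) with h | h
    · exact h
    · have : sInf S - ε ∈ S := by
        simp only [hS, Set.mem_ofPred_eq]
        convert h using 1
        simp only [map_sub]; ring
      exact absurd (csInf_le hbdd this) (by linarith)
  · obtain ⟨s, hs, hlt⟩ := exists_lt_of_csInf_lt ⟨N, hN⟩ (show sInf S < ε + sInf S by linarith)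
    exact hmono hs hlt.le

end IsStdPart

/-- A maximal archimedean module is the pullback of a real character. -/
theorem exists_algHom_of_archimedean (hT : IsPreord T) {M : Set A} (hM : IsConeModule T M)
    (h1 : (-1 : A) ∉ M) (harch : ∀ f : A, ∃ N : ℝ, algebraMap ℝ A N - f ∈ M) :
    ∃ φ : A →ₐ[ℝ] ℝ, ∀ f ∈ M, 0 ≤ φ f := by
  obtain ⟨Q, hMQ, hQ⟩ := hM.exists_maximal h1
  have hm := hQ.prop.1
  have hm1 := hQ.prop.2
  have hex := IsStdPart.exists_of_archimedean hT hm hm1 (IsConeModule.mem_or_neg_mem hT hQ)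
    (fun f => (harch f).imp fun N hN => hMQ hN)
  choose φ hφ using hex
  have hu : ∀ {f r}, IsStdPart Q f r → φ f = r := fun h => (hφ _).unique hT hm hm1 h
  refine ⟨{ toFun := φ, map_one' := ?_, map_mul' := ?_, map_zero' := ?_, map_add' := ?_,
            commutes' := ?_ }, ?_⟩
  · simpa using hu (IsStdPart.const hT hm 1)
  · exact fun f g => hu ((hφ f).mul hT hm (hφ g))
  · simpa using hu (IsStdPart.const hT hm 0)
  · exact fun f g => hu ((hφ f).add hm (hφ g))
  · exact fun r => hu (IsStdPart.const hT hm r)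
  · exact fun f hf => (hφ f).nonneg hT hm hm1 (hMQ hf)

/-- Jacobi–Putinar: in an archimedean quadratic module, strict positivity on all nonnegative
real characters implies membership. -/
theorem mem_of_pos_of_archimedean (hT : IsPreord T) {M : Set A} (hM : IsConeModule T M)
    (harch : ∀ f : A, ∃ N : ℝ, algebraMap ℝ A N - f ∈ M) {f : A}
    (hf : ∀ φ : A →ₐ[ℝ] ℝ, (∀ g ∈ M, 0 ≤ φ g) → 0 < φ f) : f ∈ M := by
  obtain ⟨q, hq, s, hs, h1⟩ : ∃ q ∈ M, ∃ s ∈ T, -1 = q + s * (-f) := by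
    by_contra hcon
    have hsub : ∀ g ∈ M, g ∈ {x | ∃ q ∈ M, ∃ t ∈ T, x = q + t * (-f)} :=
      fun g hg => ⟨g, hg, 0, hT.zero_mem, by ring⟩
    obtain ⟨φ, hφ⟩ := exists_algHom_of_archimedean hT (hM.adjoin hT (-f)) hcon
      (fun g => (harch g).imp fun N hN => hsub _ hN)
    have := hf φ (fun g hg => hφ g (hsub g hg))
    have h2 := hφ (-f) ⟨0, hM.zero_mem hT, 1, hT.one_mem, by ring⟩
    rw [map_neg] at h2
    linarith
  have hmono : ∀ {g : A} {r r' : ℝ}, algebraMap ℝ A r + g ∈ M → r ≤ r' →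
      algebraMap ℝ A r' + g ∈ M := by
    intro g r r' h hr
    have := hM.add_mem (hM.subset (hT.real_mem (sub_nonneg.2 hr))) h
    simpa [← add_assoc, ← map_add] using this
  obtain ⟨k1, hk1⟩ := harch s
  obtain ⟨k2, hk2⟩ := harch (s ^ 2 * f + 1)
  set k := max 1 (max (k1 / 2) (k2 / 2)) with hk
  have hk0 : 0 < k := lt_of_lt_of_le one_pos (le_max_left _ _)
  have hka : algebraMap ℝ A (2 * k) - s ∈ M := by
    rw [sub_eq_add_neg]
    refine hmono (r := k1) (by rwa [← sub_eq_add_neg]) ?_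
    have := (le_max_left (k1 / 2) (k2 / 2)).trans (le_max_right 1 _)
    linarith
  have hkb : algebraMap ℝ A (2 * k) - (s ^ 2 * f + 1) ∈ M := by
    rw [sub_eq_add_neg]
    refine hmono (r := k2) (by rwa [← sub_eq_add_neg]) ?_
    have := (le_max_right (k1 / 2) (k2 / 2)).trans (le_max_right 1 _)
    linarith
  have hstep : ∀ r : ℝ, 0 ≤ r → algebraMap ℝ A r + f ∈ M →
      algebraMap ℝ A (r - 1 / k ^ 2) + f ∈ M := by
    intro r hr h
    set κ := algebraMap ℝ A k with hκ
    set ρ := algebraMap ℝ A r with hρ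
    have h2k : algebraMap ℝ A (2 * k) = 2 * κ := by rw [map_mul, map_ofNat]
    have e1 := hM.mul_mem (hT.sq_mem (κ - s)) h
    have e2 := hM.mul_mem (hT.real_mem (r := 2 * k) (by positivity)) hq
    have e3 := hM.mul_mem (hT.mul_mem (hT.real_mem hr) hs) hka
    have e4 := hM.mul_mem (hT.real_mem (r := 1 / k ^ 2) (by positivity))
      (hM.add_mem (hM.add_mem e1 e2) (hM.add_mem e3 hkb))
    convert e4 using 1
    rw [h2k, map_sub, ← hρ]
    have h5 : algebraMap ℝ A (1 / k ^ 2) * κ ^ 2 = 1 := by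
      rw [hκ, ← map_pow, ← map_mul, ← map_one (algebraMap ℝ A)]
      congr 1; field_simp
    have hq' : q = s * f - 1 := by linear_combination -h1
    rw [hq']
    linear_combination (-(ρ + f)) * h5
  obtain ⟨N, hN⟩ := harch (-f)
  have hN' : algebraMap ℝ A N + f ∈ M := by simpa using hN
  have hind : ∀ j : ℕ, ∀ r : ℝ, r ≤ j * (1 / k ^ 2) → algebraMap ℝ A r + f ∈ M → f ∈ M := by
    intro j
    induction j with
    | zero =>
      intro r hr h
      simpa using hmono (r' := 0) h (by simpa using hr)
    | succ j ih =>
      intro r hr h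
      rcases le_total r 0 with h0 | h0
      · simpa using hmono h h0
      · refine ih _ ?_ (hstep r h0 h)
        push_cast at hr
        linarith
  obtain ⟨j, hj⟩ := exists_nat_ge (N / (1 / k ^ 2))
  exact hind j N ((div_le_iff₀ (by positivity)).1 hj) hN'

end Place

section ArchPoly
variable {n : ℕ} {T M : Set (MvPolynomial (Fin n) ℝ)}

/-- A module containing `R - ∑ xᵢ²` is archimedean. -/
theorem archimedean_of_ball (hT : IsPreord T) (hM : IsConeModule T M) {R : ℝ}
    (hR : C R - ∑ i, X i ^ 2 ∈ M) (f : MvPolynomial (Fin n) ℝ) :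
    ∃ N : ℝ, algebraMap ℝ _ N - f ∈ M := by
  let bdd : MvPolynomial (Fin n) ℝ → Prop := fun f => ∃ N : ℝ, 0 < N ∧ C N - f ∈ M ∧ C N + f ∈ M
  have hmono : ∀ {g : MvPolynomial (Fin n) ℝ} {r r' : ℝ}, C r + g ∈ M → r ≤ r' → C r' + g ∈ M := by
    intro g r r' h hr
    have := hM.add_mem (hM.subset (hT.real_mem (sub_nonneg.2 hr))) h
    rw [MvPolynomial.algebraMap_eq] at this
    simpa [← add_assoc, ← map_add] using this
  have hC : ∀ r : ℝ, 0 ≤ r → (C r : MvPolynomial (Fin n) ℝ) ∈ M :=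
    fun r hr => hM.subset (hT.real_mem hr)
  have badd : ∀ f g, bdd f → bdd g → bdd (f + g) := by
    rintro f g ⟨N, h0, h1, h2⟩ ⟨N', h0', h1', h2'⟩
    refine ⟨N + N', by positivity, ?_, ?_⟩
    · convert hM.add_mem h1 h1' using 1; rw [map_add]; ring
    · convert hM.add_mem h2 h2' using 1; rw [map_add]; ring
  have bneg : ∀ f, bdd f → bdd (-f) := by
    rintro f ⟨N, h0, h1, h2⟩
    exact ⟨N, h0, by simpa using h2, by simpa [← sub_eq_add_neg] using h1⟩
  have bsq : ∀ f, bdd f → bdd (f ^ 2) := by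
    rintro f ⟨N, h0, h1, h2⟩
    refine ⟨N ^ 2, by positivity, ?_, hM.add_mem (hC _ (by positivity)) (hM.subset (hT.sq_mem f))⟩
    have h3 := hM.add_mem (hM.mul_mem (hT.sq_mem (C N - f)) h2)
      (hM.mul_mem (hT.sq_mem (C N + f)) h1)
    have h4 := hM.mul_mem (hT.real_mem (r := 1 / (2 * N)) (by positivity)) h3
    convert h4 using 1
    have h5 : algebraMap ℝ (MvPolynomial (Fin n) ℝ) (1 / (2 * N)) * (2 * C N) = 1 := by
      rw [MvPolynomial.algebraMap_eq, show (2 : MvPolynomial (Fin n) ℝ) = C 2 from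
        (map_ofNat C 2).symm, ← map_mul, ← map_mul, ← C_1]
      congr 1; field_simp
    rw [map_pow]
    linear_combination (-(C N ^ 2 - f ^ 2)) * h5
  have bconst : ∀ c : ℝ, bdd (C c) := by
    intro c
    refine ⟨|c| + 1, by positivity, ?_, ?_⟩
    · rw [← map_sub]; exact hC _ (by linarith [le_abs_self c])
    · rw [← map_add]; exact hC _ (by linarith [neg_abs_le c])
  have bmul : ∀ f g, bdd f → bdd g → bdd (f * g) := by
    intro f g hf hg
    obtain ⟨N, h0, h1, h2⟩ :=
      badd _ _ (bsq _ (badd f g hf hg)) (bneg _ (bsq _ (badd f (-g) hf (bneg g hg))))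
    have hq := hT.real_mem (B := MvPolynomial (Fin n) ℝ) (r := 1 / 4) (by norm_num)
    have h4 : algebraMap ℝ (MvPolynomial (Fin n) ℝ) (1 / 4) * 4 = 1 := by
      rw [MvPolynomial.algebraMap_eq, show (4 : MvPolynomial (Fin n) ℝ) = C 4 from
        (map_ofNat C 4).symm, ← map_mul, ← C_1]
      congr 1; norm_num
    have hN : (C (N / 4) : MvPolynomial (Fin n) ℝ) = algebraMap ℝ _ (1 / 4) * C N := by
      rw [MvPolynomial.algebraMap_eq, ← map_mul]; congr 1; ring
    refine ⟨N / 4, by positivity, ?_, ?_⟩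
    · convert hM.mul_mem hq h1 using 1
      rw [hN]; linear_combination (f * g) * h4
    · convert hM.mul_mem hq h2 using 1
      rw [hN]; linear_combination (-f * g) * h4
  have bX : ∀ i, bdd (X i) := by
    intro i
    have hsum : ∑ j ∈ univ.erase i, X j ^ 2 ∈ M := by
      apply Finset.sum_induction _ (· ∈ M) (fun _ _ => hM.add_mem) (hM.zero_mem hT)
      exact fun j _ => hM.subset (hT.sq_mem _)
    have h1 : C R - X i ^ 2 ∈ M := by
      convert hM.add_mem hR hsum using 1
      rw [← Finset.add_sum_erase univ _ (Finset.mem_univ i)]; ring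
    have h2 : ∀ s : ℝ, s ^ 2 = 1 → C (|R| + 1) - C s * X i ∈ M := by
      intro s hs
      have h3 := hM.add_mem h1 (hM.subset (hT.sq_mem (X i - C (s / 2))))
      have h4 := hmono (r' := |R| + 1) (r := R + 1 / 4) (g := - (C s * X i)) (by
        convert h3 using 1
        have e1 : (C s : MvPolynomial (Fin n) ℝ) = 2 * C (s / 2) := by
          rw [show (2 : MvPolynomial (Fin n) ℝ) = C 2 from (map_ofNat C 2).symm, ← map_mul]
          congr 1; ring
        have e2 : (C (R + 1 / 4) : MvPolynomial (Fin n) ℝ) = C R + C (s / 2) ^ 2 := by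
          rw [← map_pow, ← map_add]; congr 1; linear_combination (-1 / 4) * hs
        rw [e1, e2]; ring) (by linarith [le_abs_self R])
      rwa [← sub_eq_add_neg] at h4
    refine ⟨|R| + 1, by positivity, by simpa using h2 1 (by norm_num), ?_⟩
    simpa using h2 (-1) (by norm_num)
  have hall : bdd f := by
    induction f using MvPolynomial.induction_on with
    | C a => exact bconst a
    | add p q hp hq => exact badd p q hp hq
    | mul_X p i hp => exact bmul _ _ hp (bX i)
  obtain ⟨N, -, h, -⟩ := hall
  exact ⟨N, h⟩

end ArchPoly

/-- The intermediate value property for polynomials. -/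
def PolyIVT (R : Type*) [Field R] [LinearOrder R] : Prop :=
  ∀ (f : Polynomial R) (a b : R), a ≤ b → f.eval a * f.eval b ≤ 0 → ∃ c ∈ Set.Icc a b, f.eval c = 0

section RealClosed
variable {A Ω : Type*} [CommRing A] [Field Ω] {T : Set A}

/-- The sums of elements `ψ t * l ^ 2` with `t ∈ T` and `l ∈ L`. -/
def coneIn (ψ : A →+* Ω) (T : Set A) (L : Subfield Ω) : AddSubmonoid Ω :=
  AddSubmonoid.closure {z | ∃ t ∈ T, ∃ l ∈ L, z = ψ t * l ^ 2}

theorem coneIn_mono (ψ : A →+* Ω) (T : Set A) {L L' : Subfield Ω} (h : L ≤ L') :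
    coneIn ψ T L ≤ coneIn ψ T L' :=
  AddSubmonoid.closure_mono fun _ ⟨t, ht, l, hl, hz⟩ => ⟨t, ht, l, h hl, hz⟩

theorem coneIn_mul (hT : IsPreord T) (ψ : A →+* Ω) {L : Subfield Ω} {x y : Ω}
    (hx : x ∈ coneIn ψ T L) (hy : y ∈ coneIn ψ T L) : x * y ∈ coneIn ψ T L := by
  induction hx using AddSubmonoid.closure_induction with
  | zero => simp
  | add a b _ _ ha hb => rw [add_mul]; exact add_mem ha hb
  | mem a ha =>
    obtain ⟨t, ht, l, hl, rfl⟩ := ha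
    induction hy using AddSubmonoid.closure_induction with
    | zero => simp
    | add a b _ _ ha hb => rw [mul_add]; exact add_mem ha hb
    | mem b hb =>
      obtain ⟨t', ht', l', hl', rfl⟩ := hb
      exact AddSubmonoid.subset_closure
        ⟨t * t', hT.mul_mem ht ht', l * l', mul_mem hl hl', by rw [map_mul]; ring⟩

theorem coneIn_sq (hT : IsPreord T) (ψ : A →+* Ω) {L : Subfield Ω} {l : Ω} (hl : l ∈ L) :
    l ^ 2 ∈ coneIn ψ T L :=
  AddSubmonoid.subset_closure ⟨1, hT.one_mem, l, hl, by simp⟩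

theorem coneIn_sSup (ψ : A →+* Ω) {c : Set (Subfield Ω)} (hc : DirectedOn (· ≤ ·) c)
    (hne : c.Nonempty) {z : Ω} (hz : z ∈ coneIn ψ T (sSup c)) : ∃ L ∈ c, z ∈ coneIn ψ T L := by
  induction hz using AddSubmonoid.closure_induction with
  | zero => obtain ⟨L, hL⟩ := hne; exact ⟨L, hL, zero_mem _⟩
  | add a b _ _ ha hb =>
    obtain ⟨L, hL, ha⟩ := ha
    obtain ⟨L', hL', hb⟩ := hb
    obtain ⟨K, hK, h, h'⟩ := hc L hL L' hL'
    exact ⟨K, hK, add_mem (coneIn_mono ψ T h ha) (coneIn_mono ψ T h' hb)⟩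
  | mem a ha =>
    obtain ⟨t, ht, l, hl, rfl⟩ := ha
    obtain ⟨L, hL, hlL⟩ := (Subfield.mem_sSup_of_directedOn hne hc).1 hl
    exact ⟨L, hL, AddSubmonoid.subset_closure ⟨t, ht, l, hlL, rfl⟩⟩

theorem coneIn_adjoin (ψ : A →+* Ω) {L : Subfield Ω} (hψ : ∀ a, ψ a ∈ L)
    {f : Polynomial L} (hf : Irreducible f) {α : Ω} (hα : Polynomial.aeval α f = 0) {z : Ω}
    (hz : z ∈ coneIn ψ T (IntermediateField.adjoin L {α}).toSubfield) :
    ∃ N : Polynomial L, Polynomial.aeval α N = z ∧ N.natDegree ≤ 2 * (f.natDegree - 1) ∧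
      (∀ c : L, ((N.eval c : L) : Ω) ∈ coneIn ψ T L) ∧
      ((N.coeff (2 * (f.natDegree - 1)) : L) : Ω) ∈ coneIn ψ T L := by
  have hintegral : IsIntegral L α := IsAlgebraic.isIntegral ⟨f, hf.ne_zero, hα⟩
  induction hz using AddSubmonoid.closure_induction with
  | zero => exact ⟨0, by simp⟩
  | add a b _ _ ha hb =>
    obtain ⟨N, h1, h2, h3, h4⟩ := ha
    obtain ⟨N', h1', h2', h3', h4'⟩ := hb
    refine ⟨N + N', by simp [h1, h1'], (Polynomial.natDegree_add_le _ _).trans (max_le h2 h2'),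
      fun c => ?_, ?_⟩
    · rw [Polynomial.eval_add]; exact add_mem (h3 c) (h3' c)
    · rw [Polynomial.coeff_add]; exact add_mem h4 h4'
  | mem a ha =>
    obtain ⟨t, ht, l, hl, rfl⟩ := ha
    obtain ⟨h, hdeg, hh⟩ :=
      (IntermediateField.adjoin.powerBasis hintegral).exists_eq_aeval ⟨l, hl⟩
    have hh' : l = Polynomial.aeval α h := by
      have := congrArg (algebraMap (IntermediateField.adjoin L {α}) Ω) hh
      rw [← Polynomial.aeval_algebraMap_apply, IntermediateField.adjoin.powerBasis_gen,
        IntermediateField.AdjoinSimple.algebraMap_gen] at this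
      exact this
    have hd : h.natDegree ≤ f.natDegree - 1 := by
      rw [IntermediateField.adjoin.powerBasis_dim, ← minpoly.eq_of_irreducible hf hα,
        Polynomial.natDegree_mul_C (by simpa using hf.ne_zero)] at hdeg
      omega
    have hd2 : (h ^ 2).natDegree ≤ 2 * (f.natDegree - 1) :=
      Polynomial.natDegree_pow_le.trans (by omega)
    refine ⟨Polynomial.C ⟨ψ t, hψ t⟩ * h ^ 2, ?_, (Polynomial.natDegree_C_mul_le _ _).trans hd2,
      fun c => ?_, ?_⟩
    · rw [map_mul, map_pow, ← hh', Polynomial.aeval_C]; rfl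
    · refine AddSubmonoid.subset_closure ⟨t, ht, (h.eval c : L), (h.eval c).2, by simp⟩
    · rw [Polynomial.coeff_C_mul, Polynomial.coeff_pow_of_natDegree_le hd]
      exact AddSubmonoid.subset_closure ⟨t, ht, (h.coeff (f.natDegree - 1) : L), Subtype.prop _,
        by simp⟩

end RealClosed

section Maximal
variable {A Ω : Type*} [CommRing A] [Field Ω] {T : Set A}

/-- The property of a subfield on which the order given by `T` is consistent. -/
def IsConsistent (ψ : A →+* Ω) (T : Set A) (L : Subfield Ω) : Prop :=
  (∀ a, ψ a ∈ L) ∧ (-1 : Ω) ∉ coneIn ψ T L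

theorem IsConsistent.exists_maximal {ψ : A →+* Ω} {L : Subfield Ω} (hL : IsConsistent ψ T L) :
    ∃ L', Maximal (IsConsistent ψ T) L' := by
  obtain ⟨L', -, h⟩ := zorn_le_nonempty₀ {L | IsConsistent ψ T L} (fun c hc hchain y hy => by
    refine ⟨sSup c, ⟨fun a => ?_, fun h => ?_⟩, fun z hz => le_sSup hz⟩
    · exact (le_sSup hy : y ≤ sSup c) ((hc hy).1 a)
    · obtain ⟨L, hL, h⟩ := coneIn_sSup ψ hchain.directedOn ⟨y, hy⟩ h
      exact (hc hL).2 h) L hL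
  exact ⟨L', h⟩

variable {ψ : A →+* Ω} {L : Subfield Ω}

theorem neg_one_mem_of_notMem (hL : Maximal (IsConsistent ψ T) L) {α : Ω} (hα : α ∉ L) :
    (-1 : Ω) ∈ coneIn ψ T (IntermediateField.adjoin L {α}).toSubfield := by
  by_contra hcon
  have hle : L ≤ (IntermediateField.adjoin L {α}).toSubfield := fun x hx =>
    (IntermediateField.adjoin L {α}).algebraMap_mem ⟨x, hx⟩
  exact hα (hL.le_of_ge (y := (IntermediateField.adjoin L {α}).toSubfield)
    ⟨fun a => hle (hL.prop.1 a), hcon⟩ hle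
    (IntermediateField.mem_adjoin_simple_self L α))

variable [IsAlgClosed Ω]

theorem coneIn_total (hT : IsPreord T) (hL : Maximal (IsConsistent ψ T) L) {a : Ω} (ha : a ∈ L) :
    a ∈ coneIn ψ T L ∨ -a ∈ coneIn ψ T L := by
  obtain ⟨α, hα⟩ := IsAlgClosed.exists_pow_nat_eq (-a) (n := 2) (by norm_num)
  by_cases hαL : α ∈ L
  · right; rw [← hα]; exact coneIn_sq hT ψ hαL
  left
  set f : Polynomial L := Polynomial.X ^ 2 + Polynomial.C ⟨a, ha⟩ with hf
  have hdeg : f.natDegree = 2 := Polynomial.natDegree_X_pow_add_C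
  have hroot : Polynomial.aeval α f = 0 := by
    simp only [hf, map_add, map_pow, Polynomial.aeval_X, Polynomial.aeval_C, hα]
    exact neg_add_cancel a
  have hirr : Irreducible f := by
    refine Polynomial.irreducible_of_degree_le_three_of_not_isRoot (by simp [hdeg]) ?_
    intro x hx
    have hx2 : (x : Ω) ^ 2 = -a := by
      have h0 : x ^ 2 + ⟨a, ha⟩ = 0 := by simpa [hf, Polynomial.IsRoot] using hx
      have := congrArg (Subtype.val : L → Ω) h0
      push_cast at this
      linear_combination this
    rcases sq_eq_sq_iff_eq_or_eq_neg.1 (hα.trans hx2.symm) with h | h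
    · exact hαL (h ▸ x.2)
    · exact hαL (h ▸ neg_mem x.2)
  obtain ⟨N, h1, h2, h3, h4⟩ := coneIn_adjoin ψ hL.prop.1 hirr hroot (neg_one_mem_of_notMem hL hαL)
  have hdvd : f ∣ N + 1 := by
    have : minpoly L α ∣ N + 1 := minpoly.dvd _ _ (by simp [h1])
    rwa [← minpoly.eq_of_irreducible hirr hroot,
      (Polynomial.isUnit_C.2 (by simpa using hirr.ne_zero)).mul_right_dvd] at this
  obtain ⟨g, hg⟩ := hdvd
  rw [hdeg] at h2 h4
  have hN1 : N + 1 ≠ 0 := by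
    intro h0
    apply hL.prop.2
    have := h3 0
    rw [eq_neg_of_add_eq_zero_left h0] at this
    simpa using this
  have hg0 : g ≠ 0 := by rintro rfl; simp at hg; exact hN1 hg
  have hgd : g.natDegree = 0 := by
    have : (N + 1).natDegree ≤ 2 :=
      (Polynomial.natDegree_add_le _ _).trans (by simpa using h2)
    rw [hg, Polynomial.natDegree_mul hirr.ne_zero hg0, hdeg] at this
    omega
  obtain ⟨γ, rfl⟩ := Polynomial.natDegree_eq_zero.1 hgd
  have hγ : N.coeff 2 = γ := by
    have := congrArg (fun p => Polynomial.coeff p 2) hg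
    simpa [hf, Polynomial.coeff_one, Polynomial.coeff_C] using this
  have hγ0 : (γ : Ω) ≠ 0 := by
    intro h; apply hg0; rw [Polynomial.C_eq_zero]; exact Subtype.ext h
  have hN0 : N.eval 0 + 1 = ⟨a, ha⟩ * γ := by
    have := congrArg (fun p => Polynomial.eval 0 p) hg
    simpa [hf] using this
  have hN0' : ((N.eval 0 : L) : Ω) + 1 = a * γ := by
    have := congrArg (Subtype.val : L → Ω) hN0
    simpa using this
  have hγm : (γ : Ω) ∈ coneIn ψ T L := by rw [← hγ]; simpa using h4
  have h1m : (1 : Ω) ∈ coneIn ψ T L := by simpa using coneIn_sq hT ψ (one_mem L)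
  have : a = (((N.eval 0 : L) : Ω) + 1) * γ * ((γ : Ω)⁻¹) ^ 2 := by
    rw [hN0']; field_simp
  rw [this]
  exact coneIn_mul hT ψ (coneIn_mul hT ψ (add_mem (h3 0) h1m) hγm)
    (coneIn_sq hT ψ (inv_mem γ.2))

theorem polyIVT_of_maximal [LinearOrder L] [IsStrictOrderedRing L]
    (hL : Maximal (IsConsistent ψ T) L)
    (hpos : ∀ x : L, (x : Ω) ∈ coneIn ψ T L → 0 ≤ x) : PolyIVT L := by
  intro f
  induction hn : f.natDegree using Nat.strong_induction_on generalizing f with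
  | _ n ih =>
  intro a b hab hsign
  by_cases hf0 : f = 0
  · exact ⟨a, ⟨le_rfl, hab⟩, by simp [hf0]⟩
  by_cases hunit : IsUnit f
  · obtain ⟨c, hc, rfl⟩ := Polynomial.isUnit_iff.1 hunit
    simp only [Polynomial.eval_C] at hsign
    have : 0 < c * c := mul_self_pos.2 hc.ne_zero
    exact absurd hsign (not_le.2 this)
  by_cases hirr : Irreducible f
  swap
  · have hex : ∃ g h : Polynomial L, f = g * h ∧ ¬ IsUnit g ∧ ¬ IsUnit h := by
      by_contra! hcon
      exact hirr ⟨hunit, fun g h hgh => by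
        by_contra! h'
        exact h'.2 (hcon g h hgh h'.1)⟩
    obtain ⟨g, h, rfl, hg, hh⟩ := hex
    have hg0 : g ≠ 0 := left_ne_zero_of_mul hf0
    have hh0 : h ≠ 0 := right_ne_zero_of_mul hf0
    have hgd : 0 < g.natDegree := by
      by_contra! h0; exact hg (Polynomial.isUnit_iff_degree_eq_zero.2
        (by rw [Polynomial.degree_eq_natDegree hg0, Nat.le_zero.1 h0]; rfl))
    have hhd : 0 < h.natDegree := by
      by_contra! h0; exact hh (Polynomial.isUnit_iff_degree_eq_zero.2
        (by rw [Polynomial.degree_eq_natDegree hh0, Nat.le_zero.1 h0]; rfl))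
    rw [Polynomial.natDegree_mul hg0 hh0] at hn
    rcases le_or_gt (g.eval a * g.eval b) 0 with h1 | h1
    · obtain ⟨c, hc, h2⟩ := ih g.natDegree (by omega) g rfl a b hab h1
      exact ⟨c, hc, by simp [h2]⟩
    · have h1' : h.eval a * h.eval b ≤ 0 := by
        by_contra! h3
        have := mul_pos h1 h3
        simp only [Polynomial.eval_mul] at hsign
        linarith
      obtain ⟨c, hc, h2⟩ := ih h.natDegree (by omega) h rfl a b hab h1'
      exact ⟨c, hc, by simp [h2]⟩
  obtain ⟨α, hroot⟩ := IsAlgClosed.exists_aeval_eq_zero Ω f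
    (Polynomial.degree_pos_of_irreducible hirr).ne'
  by_cases hαL : α ∈ L
  · have hev : f.eval ⟨α, hαL⟩ = 0 := by
      apply Subtype.ext
      have : algebraMap L Ω (f.eval ⟨α, hαL⟩) = Polynomial.aeval α f := by
        rw [← Polynomial.aeval_algebraMap_apply_eq_algebraMap_eval]; rfl
      rw [hroot] at this
      exact this
    obtain ⟨g, hg⟩ := Polynomial.dvd_iff_isRoot.2 hev
    have hgu : IsUnit g := (hirr.isUnit_or_isUnit hg).resolve_left (Polynomial.not_isUnit_X_sub_C _)
    obtain ⟨c, hc, rfl⟩ := Polynomial.isUnit_iff.1 hgu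
    have hc2 : 0 < c * c := mul_self_pos.2 hc.ne_zero
    rw [hg] at hsign
    simp only [Polynomial.eval_mul, Polynomial.eval_sub, Polynomial.eval_X,
      Polynomial.eval_C] at hsign
    set α' : L := ⟨α, hαL⟩
    have h3 : (a - α') * (b - α') ≤ 0 := by
      by_contra! h
      have := mul_pos h hc2
      nlinarith
    refine ⟨α', ⟨?_, ?_⟩, hev⟩
    · by_contra! h; nlinarith [mul_pos (sub_pos.2 h) (sub_pos.2 (h.trans_le hab))]
    · by_contra! h; nlinarith [mul_pos (sub_pos.2 h) (sub_pos.2 (hab.trans_lt h))]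
  · obtain ⟨N, h1, h2, h3, h4⟩ :=
      coneIn_adjoin ψ hL.prop.1 hirr hroot (neg_one_mem_of_notMem hL hαL)
    have hN : ∀ c, 0 < (N + 1).eval c := by
      intro c
      have := hpos _ (h3 c)
      simp only [Polynomial.eval_add, Polynomial.eval_one]
      linarith
    have hdvd : f ∣ N + 1 := by
      have : minpoly L α ∣ N + 1 := minpoly.dvd _ _ (by simp [h1])
      rwa [← minpoly.eq_of_irreducible hirr hroot,
        (Polynomial.isUnit_C.2 (by simpa using hirr.ne_zero)).mul_right_dvd] at this
    obtain ⟨g, hg⟩ := hdvd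
    have hg0 : g ≠ 0 := by
      rintro rfl
      have := hN 0
      rw [hg] at this
      simp at this
    have hfd := hirr.natDegree_pos
    have hgd : g.natDegree < n := by
      have : (N + 1).natDegree ≤ 2 * (f.natDegree - 1) :=
        (Polynomial.natDegree_add_le _ _).trans (by simpa using h2)
      rw [hg, Polynomial.natDegree_mul hirr.ne_zero hg0] at this
      omega
    have ha := hN a
    have hb := hN b
    rw [hg, Polynomial.eval_mul] at ha hb
    have hgs : g.eval a * g.eval b ≤ 0 := by
      by_contra! h
      have h5 := mul_pos ha hb
      have h6 : f.eval a * g.eval a * (f.eval b * g.eval b)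
        = (f.eval a * f.eval b) * (g.eval a * g.eval b) := by ring
      have h7 := mul_nonpos_of_nonpos_of_nonneg hsign h.le
      rw [h6] at h5
      exact absurd h7 (not_le.2 h5)
    obtain ⟨c, hc, h8⟩ := ih g.natDegree hgd g rfl a b hab hgs
    have := hN c
    rw [hg, Polynomial.eval_mul, h8, mul_zero] at this
    exact absurd this (lt_irrefl _)

end Maximal

section OrderedField
variable {A : Type*} [CommRing A] {T : Set A}

theorem isConsistent_fieldRange {Q : Set A} (hT : IsPreord T)
    (hQ : Maximal (fun Q => IsConeModule T Q ∧ (-1 : A) ∉ Q) Q)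
    {F Ω : Type*} [Field F] [Field Ω] (i : F →+* Ω) (θ : A →+* F)
    (hθ : ∀ x, θ x = 0 ↔ x ∈ Q ∧ -x ∈ Q)
    (hfrac : ∀ x : F, ∃ a b, θ b ≠ 0 ∧ x * θ b = θ a) :
    IsConsistent (i.comp θ) T i.fieldRange := by
  refine ⟨fun a => ⟨θ a, rfl⟩, fun hcon => ?_⟩
  have hm := hQ.prop.1
  have key : ∀ z ∈ coneIn (i.comp θ) T i.fieldRange,
      ∃ t ∈ T, ∃ s, θ s ≠ 0 ∧ z * i (θ s) ^ 2 = i (θ t) := by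
    intro z hz
    induction hz using AddSubmonoid.closure_induction with
    | zero => exact ⟨0, hT.zero_mem, 1, by simp, by simp⟩
    | add a b _ _ ha hb =>
      obtain ⟨t, ht, s, hs, h⟩ := ha
      obtain ⟨t', ht', s', hs', h'⟩ := hb
      refine ⟨s' ^ 2 * t + s ^ 2 * t', hT.add_mem (hT.mul_mem (hT.sq_mem _) ht)
        (hT.mul_mem (hT.sq_mem _) ht'), s * s', by simp [hs, hs'], ?_⟩
      simp only [map_add, map_mul, map_pow]
      linear_combination i (θ s') ^ 2 * h + i (θ s) ^ 2 * h'
    | mem a ha =>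
      obtain ⟨t, ht, l, ⟨l, rfl⟩, rfl⟩ := ha
      obtain ⟨a, b, hb, hab⟩ := hfrac l
      refine ⟨t * a ^ 2, hT.mul_mem ht (hT.sq_mem a), b, hb, ?_⟩
      simp only [map_mul, map_pow, RingHom.comp_apply, ← hab]
      ring
  obtain ⟨t, ht, s, hs, h⟩ := key _ hcon
  have h0 : θ (s ^ 2 + t) = 0 := by
    apply i.injective
    simp only [map_add, map_pow, map_zero]
    linear_combination -h
  have h1 : -(s ^ 2) ∈ Q := by
    have : -(s ^ 2) = -(s ^ 2 + t) + t := by ring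
    rw [this]
    exact hm.add_mem ((hθ _).1 h0).2 (hm.subset ht)
  have h2 : θ (s ^ 2) = 0 := (hθ _).2 ⟨hm.subset (hT.sq_mem s), h1⟩
  rw [map_pow] at h2
  exact hs (pow_eq_zero_iff two_ne_zero |>.1 h2)

theorem eq_zero_of_coneIn {Ω : Type*} [Field Ω] (hT : IsPreord T) {ψ : A →+* Ω} {L : Subfield Ω}
    (hL : IsConsistent ψ T L) {x : Ω} (hxL : x ∈ L) (hx : x ∈ coneIn ψ T L)
    (hx' : -x ∈ coneIn ψ T L) : x = 0 := by
  by_contra h0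
  apply hL.2
  have : -1 = -x * x * (x⁻¹) ^ 2 := by field_simp
  rw [this]
  exact coneIn_mul hT ψ (coneIn_mul hT ψ hx' hx) (coneIn_sq hT ψ (inv_mem hxL))

variable [Algebra ℝ A]

/-- The support of a maximal proper module, as an ideal. -/
def supportIdeal {Q : Set A} (hT : IsPreord T) (hQ : IsConeModule T Q) : Ideal A where
  carrier := {a | a ∈ Q ∧ -a ∈ Q}
  add_mem' := fun ⟨h1, h2⟩ ⟨h3, h4⟩ =>
    ⟨hQ.add_mem h1 h3, by rw [neg_add]; exact hQ.add_mem h2 h4⟩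
  zero_mem' := ⟨hQ.zero_mem hT, by simpa using hQ.zero_mem hT⟩
  smul_mem' := fun c x ⟨h1, h2⟩ => ⟨IsConeModule.support_mul hT hQ h1 h2 c, by
    have := IsConeModule.support_mul hT hQ h2 (by simpa using h1) c
    simpa using this⟩

theorem supportIdeal_isPrime {Q : Set A} (hT : IsPreord T)
    (hQ : Maximal (fun Q => IsConeModule T Q ∧ (-1 : A) ∉ Q) Q) :
    (supportIdeal hT hQ.prop.1).IsPrime where
  ne_top' := fun h => hQ.prop.2 (((Ideal.eq_top_iff_one _).1 h).2)
  mem_or_mem' := fun h => IsConeModule.support_prime hT hQ h.1 h.2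

/-- A proper preordering is nonnegative under some homomorphism to an ordered field with the
intermediate value property. -/
theorem exists_orderedField {A : Type} [CommRing A] [Algebra ℝ A] {T : Set A}
    (hT : IsPreord T) (h1 : (-1 : A) ∉ T) :
    ∃ (L : Type) (_ : Field L) (_ : LinearOrder L) (_ : IsStrictOrderedRing L) (φ : A →+* L),
      PolyIVT L ∧ ∀ t ∈ T, 0 ≤ φ t := by
  obtain ⟨Q, hTQ, hQ⟩ := IsConeModule.exists_maximal hT.isConeModule h1
  have := supportIdeal_isPrime hT hQ
  let F := FractionRing (A ⧸ supportIdeal hT hQ.prop.1)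
  let Ω := AlgebraicClosure F
  let θ : A →+* F := (algebraMap (A ⧸ supportIdeal hT hQ.prop.1) F).comp (Ideal.Quotient.mk _)
  have hθ : ∀ x, θ x = 0 ↔ x ∈ Q ∧ -x ∈ Q := by
    intro x
    rw [RingHom.comp_apply, FaithfulSMul.algebraMap_eq_zero_iff, Ideal.Quotient.eq_zero_iff_mem]
    rfl
  have hcons := isConsistent_fieldRange hT hQ (algebraMap F Ω) θ hθ (by
    intro x
    obtain ⟨a, b, hb, rfl⟩ := IsFractionRing.div_surjective (A := A ⧸ supportIdeal hT hQ.prop.1) x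
    obtain ⟨a, rfl⟩ := Ideal.Quotient.mk_surjective a
    obtain ⟨b, rfl⟩ := Ideal.Quotient.mk_surjective b
    have hb0 : θ b ≠ 0 := by
      rw [RingHom.comp_apply, Ne, FaithfulSMul.algebraMap_eq_zero_iff]
      exact nonZeroDivisors.ne_zero hb
    exact ⟨a, b, hb0, div_mul_cancel₀ _ hb0⟩)
  obtain ⟨L, hL⟩ := hcons.exists_maximal
  set ψ := (algebraMap F Ω).comp θ
  let C : RingCone L :=
    { carrier := {x | (x : Ω) ∈ coneIn ψ T L}
      add_mem' := fun ha hb => (coneIn ψ T L).add_mem ha hb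
      mul_mem' := fun ha hb => coneIn_mul hT ψ ha hb
      zero_mem' := zero_mem (coneIn ψ T L)
      one_mem' := by simpa using coneIn_sq hT ψ (one_mem L)
      eq_zero_of_mem_of_neg_mem' := fun {x} hx hx' =>
        Subtype.ext (eq_zero_of_coneIn hT hL.prop x.2 hx hx') }
  have : HasMemOrNegMem C := ⟨fun x => coneIn_total hT hL x.2⟩
  let _ : DecidablePred (· ∈ C) := Classical.decPred _
  let ord : LinearOrder L := LinearOrder.mkOfAddGroupCone C
  have : IsOrderedRing L := IsOrderedRing.mkOfCone C
  have : IsStrictOrderedRing L := IsOrderedRing.toIsStrictOrderedRing L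
  have hnn : ∀ x : L, (x : Ω) ∈ coneIn ψ T L → 0 ≤ x := fun x hx => by
    change x - 0 ∈ C
    rw [sub_zero]; exact hx
  refine ⟨L, inferInstance, ord, inferInstance, ψ.codRestrict L hL.prop.1,
    polyIVT_of_maximal hL hnn, fun t ht => hnn _ ?_⟩
  exact AddSubmonoid.subset_closure ⟨t, ht, 1, one_mem L, by simp⟩

end OrderedField

section PolyIVTField
variable {R : Type*} [Field R] [LinearOrder R]

theorem PolyIVT.exists_root_Ioo (hR : PolyIVT R) {f : Polynomial R} {a b : R} (hab : a < b)
    (h : f.eval a * f.eval b < 0) : ∃ c ∈ Set.Ioo a b, f.eval c = 0 := by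
  obtain ⟨c, hc, h0⟩ := hR f a b hab.le h.le
  refine ⟨c, ⟨hc.1.lt_of_ne ?_, hc.2.lt_of_ne ?_⟩, h0⟩
  · rintro rfl; simp [h0] at h
  · rintro rfl; simp [h0] at h

variable [IsStrictOrderedRing R]

/-- Rolle's theorem. -/
theorem PolyIVT.rolle (hR : PolyIVT R) {f : Polynomial R} {a b : R} (hab : a < b)
    (ha : f.eval a = 0) (hb : f.eval b = 0) : ∃ c ∈ Set.Ioo a b, f.derivative.eval c = 0 := by
  by_cases hf : f = 0
  · obtain ⟨c, hc⟩ := exists_between hab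
    exact ⟨c, hc, by simp [hf]⟩
  have hne : (f.roots.toFinset.filter (· < b)).Nonempty :=
    ⟨a, by simp [hf, Polynomial.IsRoot, ha, hab]⟩
  obtain ⟨u, hu, hmax⟩ := Finset.exists_max_image _ id hne
  simp only [Finset.mem_filter, Multiset.mem_toFinset, Polynomial.mem_roots hf,
    Polynomial.IsRoot, id] at hu hmax
  have hau : a ≤ u := hmax a ⟨ha, hab⟩
  obtain ⟨hu0, hub⟩ := hu
  obtain ⟨g, hfg, hgu⟩ := Polynomial.exists_eq_pow_rootMultiplicity_mul_and_not_dvd f hf u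
  obtain ⟨m, hm⟩ : ∃ m, f.rootMultiplicity u = m + 1 :=
    Nat.exists_eq_succ_of_ne_zero ((Polynomial.rootMultiplicity_pos hf).2 hu0).ne'
  rw [hm] at hfg
  have hg0 : g ≠ 0 := by rintro rfl; simp at hgu
  have hgb : g.eval b = 0 := by
    rw [hfg] at hb
    simpa [sub_eq_zero, hub.ne'] using hb
  obtain ⟨h, hgh, hhb⟩ := Polynomial.exists_eq_pow_rootMultiplicity_mul_and_not_dvd g hg0 b
  obtain ⟨k, hk⟩ : ∃ k, g.rootMultiplicity b = k + 1 :=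
    Nat.exists_eq_succ_of_ne_zero ((Polynomial.rootMultiplicity_pos hg0).2 hgb).ne'
  rw [hk] at hgh
  rw [Polynomial.dvd_iff_isRoot, Polynomial.IsRoot] at hgu hhb
  have hhu : h.eval u ≠ 0 := by
    intro h0; apply hgu; rw [hgh]; simp [h0]
  have hpos : 0 < h.eval u * h.eval b := by
    by_contra! hneg
    obtain ⟨c, hc, hc0⟩ := hR h u b hub.le hneg
    have hcb : c < b := hc.2.lt_of_ne (by rintro rfl; exact hhb hc0)
    have := hmax c ⟨by rw [hfg, hgh]; simp [hc0], hcb⟩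
    exact hhu (by rwa [le_antisymm this hc.1] at hc0)
  set q : Polynomial R := Polynomial.C ((m + 1 : ℕ) : R) * (Polynomial.X - Polynomial.C b) * h +
    Polynomial.C ((k + 1 : ℕ) : R) * (Polynomial.X - Polynomial.C u) * h +
    (Polynomial.X - Polynomial.C u) * (Polynomial.X - Polynomial.C b) * h.derivative with hq
  have hder : f.derivative = (Polynomial.X - Polynomial.C u) ^ m *
      (Polynomial.X - Polynomial.C b) ^ k * q := by
    rw [hfg, hgh, hq]
    simp only [Polynomial.derivative_mul, Polynomial.derivative_X_sub_C_pow, Nat.add_sub_cancel]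
    ring
  have hqu : q.eval u = ((m + 1 : ℕ) : R) * (u - b) * h.eval u := by simp [hq]
  have hqb : q.eval b = ((k + 1 : ℕ) : R) * (b - u) * h.eval b := by simp [hq]
  have hprod : q.eval u * q.eval b < 0 := by
    have h1 : 0 < ((m + 1 : ℕ) : R) * ((k + 1 : ℕ) : R) := by positivity
    have h2 := mul_pos (sub_pos.2 hub) (sub_pos.2 hub)
    have h3 := mul_pos (mul_pos h1 h2) hpos
    rw [hqu, hqb]
    linarith
  obtain ⟨c, hc, hc0⟩ := hR.exists_root_Ioo hub hprod
  exact ⟨c, ⟨hau.trans_lt hc.1, hc.2⟩, by rw [hder]; simp [hc0]⟩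

/-- The mean value theorem. -/
theorem PolyIVT.mvt (hR : PolyIVT R) (f : Polynomial R) {a b : R} (hab : a < b) :
    ∃ c ∈ Set.Ioo a b, f.derivative.eval c * (b - a) = f.eval b - f.eval a := by
  set s := (f.eval b - f.eval a) / (b - a) with hs
  have hba : b - a ≠ 0 := (sub_pos.2 hab).ne'
  have hsm : s * (b - a) = f.eval b - f.eval a := div_mul_cancel₀ _ hba
  obtain ⟨c, hc, h⟩ := hR.rolle
    (f := f - Polynomial.C (f.eval a) - Polynomial.C s * (Polynomial.X - Polynomial.C a))
    hab (by simp) (by simp [hsm])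
  refine ⟨c, hc, ?_⟩
  simp only [Polynomial.derivative_sub, Polynomial.derivative_C, Polynomial.derivative_C_mul,
    Polynomial.derivative_X, sub_zero, mul_one, Polynomial.eval_sub, Polynomial.eval_C] at h
  rw [sub_eq_zero.1 h, hsm]

theorem exists_forall_gt_le_eval {f : Polynomial R} (hf : 0 < f.leadingCoeff) :
    ∃ ε > 0, ∃ B, ∀ t, B < t → ε ≤ f.eval t := by
  induction hn : f.natDegree generalizing f with
  | zero =>
    refine ⟨f.leadingCoeff, hf, 0, fun t _ => ?_⟩
    rw [Polynomial.eq_C_of_natDegree_eq_zero hn]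
    simp
  | succ n ih =>
    have hdeg : f.divX.natDegree = n := by rw [Polynomial.natDegree_divX_eq_natDegree_tsub_one, hn]; simp
    have hlc : f.divX.leadingCoeff = f.leadingCoeff := by
      rw [Polynomial.leadingCoeff, Polynomial.leadingCoeff, hdeg, hn, Polynomial.coeff_divX]
    obtain ⟨ε, hε, B, h⟩ := ih (f := f.divX) (by rwa [hlc]) hdeg
    refine ⟨ε, hε, max B (1 + |f.coeff 0| / ε), fun t ht => ?_⟩
    have h1 := h t ((le_max_left _ _).trans_lt ht)
    have h2 := (le_max_right _ _).trans_lt ht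
    have h3 : |f.coeff 0| / ε * ε = |f.coeff 0| := div_mul_cancel₀ _ hε.ne'
    have h4 : 0 ≤ |f.coeff 0| / ε := by positivity
    have h5 : (1 + |f.coeff 0| / ε) * ε ≤ t * ε := mul_le_mul_of_nonneg_right h2.le hε.le
    have h6 : t * ε ≤ t * f.divX.eval t := mul_le_mul_of_nonneg_left h1 (by linarith)
    have h7 := neg_abs_le (f.coeff 0)
    have h8 : f.eval t = t * f.divX.eval t + f.coeff 0 := by
      have := congrArg (Polynomial.eval t) (Polynomial.divX_mul_X_add f)
      rw [Polynomial.eval_add, Polynomial.eval_mul, Polynomial.eval_X, Polynomial.eval_C] at this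
      rw [← this, mul_comm]
    rw [h8]
    linarith

theorem exists_forall_gt_sign_eval (f : Polynomial R) :
    ∃ B, ∀ t, B < t → SignType.sign (f.eval t) = SignType.sign f.leadingCoeff := by
  rcases lt_trichotomy f.leadingCoeff 0 with h | h | h
  · obtain ⟨ε, hε, B, hB⟩ := exists_forall_gt_le_eval (f := -f) (by simpa using h)
    refine ⟨B, fun t ht => ?_⟩
    have := hB t ht
    rw [Polynomial.eval_neg] at this
    rw [sign_neg h, sign_neg (by linarith)]
  · rw [Polynomial.leadingCoeff_eq_zero.1 h]; simp
  · obtain ⟨ε, hε, B, hB⟩ := exists_forall_gt_le_eval h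
    exact ⟨B, fun t ht => by rw [sign_pos h, sign_pos (hε.trans_le (hB t ht))]⟩

theorem exists_gt_sign_eval_eq {R' : Type*} [Field R'] [LinearOrder R'] [IsStrictOrderedRing R']
    {f : Polynomial R} {g : Polynomial R'}
    (h : SignType.sign f.leadingCoeff = SignType.sign g.leadingCoeff) (x : R) (y : R') :
    ∃ u v, x < u ∧ y < v ∧ SignType.sign (f.eval u) = SignType.sign (g.eval v) := by
  obtain ⟨B, hB⟩ := exists_forall_gt_sign_eval f
  obtain ⟨B', hB'⟩ := exists_forall_gt_sign_eval g
  obtain ⟨u, hu⟩ := exists_gt (max x B)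
  obtain ⟨v, hv⟩ := exists_gt (max y B')
  rw [max_lt_iff] at hu hv
  exact ⟨u, v, hu.1, hv.1, by rw [hB u hu.2, hB' v hv.2, h]⟩

theorem exists_lt_sign_eval_eq {R' : Type*} [Field R'] [LinearOrder R'] [IsStrictOrderedRing R']
    {f : Polynomial R} {g : Polynomial R'} (hd : f.natDegree = g.natDegree)
    (h : SignType.sign f.leadingCoeff = SignType.sign g.leadingCoeff) (x : R) (y : R') :
    ∃ u v, u < x ∧ v < y ∧ SignType.sign (f.eval u) = SignType.sign (g.eval v) := by
  obtain ⟨u, v, hu, hv, huv⟩ := exists_gt_sign_eval_eq (f := f.comp (-Polynomial.X))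
    (g := g.comp (-Polynomial.X)) (by
      rw [Polynomial.leadingCoeff_comp (by simp), Polynomial.leadingCoeff_comp (by simp)]
      simp [sign_mul, h, hd, sign_pow]) (-x) (-y)
  exact ⟨-u, -v, by linarith, by linarith, by simpa using huv⟩

end PolyIVTField

section Cells
variable {R R' : Type*}

/-- The pairs in `W` form an order-preserving partial bijection. -/
def IsOrderIso [LT R] [LT R'] (W : Set (R × R')) : Prop :=
  ∀ p ∈ W, ∀ q ∈ W, p.1 < q.1 ↔ p.2 < q.2

/-- `x` lies with respect to the first components of `W` as `y` does with respect to the second. -/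
def SameCell [LT R] [LT R'] (W : Set (R × R')) (x : R) (y : R') : Prop :=
  ∀ p ∈ W, (p.1 < x ↔ p.2 < y) ∧ (x < p.1 ↔ y < p.2)

section Order
variable [LinearOrder R] [LinearOrder R'] {W V : Set (R × R')}

theorem IsOrderIso.sameCell (hW : IsOrderIso W) {p : R × R'} (hp : p ∈ W) :
    SameCell W p.1 p.2 := fun q hq => ⟨hW q hq p hp, hW p hp q hq⟩

theorem SameCell.mono (h : W ⊆ V) {x : R} {y : R'} (hxy : SameCell V x y) : SameCell W x y :=
  fun p hp => hxy p (h hp)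

theorem IsOrderIso.swap (hW : IsOrderIso W) : IsOrderIso (Prod.swap ⁻¹' W) :=
  fun p hp q hq => (hW p.swap hp q.swap hq).symm

theorem SameCell.swap {x : R} {y : R'} (h : SameCell W x y) : SameCell (Prod.swap ⁻¹' W) y x :=
  fun p hp => ⟨(h p.swap hp).1.symm, (h p.swap hp).2.symm⟩

theorem SameCell.eq_iff {x : R} {y : R'} (h : SameCell W x y) {p : R × R'} (hp : p ∈ W) :
    p.1 = x ↔ p.2 = y := by
  have := h p hp
  constructor
  · rintro rfl
    exact le_antisymm (not_lt.1 fun h' => lt_irrefl _ (this.2.2 h'))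
      (not_lt.1 fun h' => lt_irrefl _ (this.1.2 h'))
  · rintro rfl
    exact le_antisymm (not_lt.1 fun h' => lt_irrefl _ (this.2.1 h'))
      (not_lt.1 fun h' => lt_irrefl _ (this.1.1 h'))

theorem sameCell_of_lt {x : R} {y : R'} (hx : ∀ p ∈ W, p.1 ≠ x)
    (h1 : ∀ p ∈ W, p.1 < x → p.2 < y) (h2 : ∀ p ∈ W, x < p.1 → y < p.2) : SameCell W x y := by
  intro p hp
  rcases lt_trichotomy p.1 x with h | h | h
  · have := h1 p hp h
    exact ⟨iff_of_true h this, iff_of_false h.not_gt this.not_gt⟩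
  · exact absurd h (hx p hp)
  · have := h2 p hp h
    exact ⟨iff_of_false h.not_gt this.not_gt, iff_of_true h this⟩

theorem IsOrderIso.exists_sameCell [DenselyOrdered R'] [NoMinOrder R'] [NoMaxOrder R']
    [Nonempty R'] (hW : IsOrderIso W) (hfin : W.Finite) (x : R) : ∃ y, SameCell W x y := by
  by_cases hx : ∃ p ∈ W, p.1 = x
  · obtain ⟨p, hp, rfl⟩ := hx
    exact ⟨p.2, hW.sameCell hp⟩
  push Not at hx
  have h1 := (hfin.subset (Set.sep_subset W fun p => p.1 < x)).image Prod.snd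
  have h2 := (hfin.subset (Set.sep_subset W fun p => x < p.1)).image Prod.snd
  obtain ⟨y, hy1, hy2⟩ := Order.exists_between_finsets (lo := h1.toFinset) (hi := h2.toFinset) (by
    simp only [Set.Finite.mem_toFinset]
    rintro _ ⟨p, ⟨hp, hpx⟩, rfl⟩ _ ⟨q, ⟨hq, hqx⟩, rfl⟩
    exact (hW p hp q hq).1 (lt_trans hpx hqx))
  simp only [Set.Finite.mem_toFinset] at hy1 hy2
  exact ⟨y, sameCell_of_lt hx (fun p hp h => hy1 _ ⟨p, ⟨hp, h⟩, rfl⟩)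
    (fun p hp h => hy2 _ ⟨p, ⟨hp, h⟩, rfl⟩)⟩

end Order

variable [Field R] [LinearOrder R] [Field R'] [LinearOrder R'] {W V : Set (R × R')}
variable {f : Polynomial R} {f' : Polynomial R'}

/-- `f` and `f'` have the same signs on corresponding cells of `W`. -/
def SameSign (W : Set (R × R')) (f : Polynomial R) (f' : Polynomial R') : Prop :=
  ∀ x y, SameCell W x y → SignType.sign (f.eval x) = SignType.sign (f'.eval y)

theorem SameSign.swap (h : SameSign W f f') : SameSign (Prod.swap ⁻¹' W) f' f :=
  fun y x hxy => (h x y hxy.swap).symm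

variable [IsStrictOrderedRing R] [IsStrictOrderedRing R']

theorem exists_left (hW : IsOrderIso W) (hfin : W.Finite) (hd : f.natDegree = f'.natDegree)
    (hlc : SignType.sign f.leadingCoeff = SignType.sign f'.leadingCoeff)
    (hsgn : ∀ p ∈ W, SignType.sign (f.eval p.1) = SignType.sign (f'.eval p.2))
    {x : R} {y : R'} (hxy : SameCell W x y) :
    ∃ u v, u < x ∧ v < y ∧ SignType.sign (f.eval u) = SignType.sign (f'.eval v) ∧
      ∀ p ∈ W, p.1 < x → p.1 ≤ u ∧ p.2 ≤ v := by
  by_cases hne : ({p ∈ W | p.1 < x}).Nonempty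
  · obtain ⟨p, ⟨hp, hpx⟩, hmax⟩ :=
      Set.exists_max_image _ Prod.fst (hfin.subset (Set.sep_subset W _)) hne
    refine ⟨p.1, p.2, hpx, (hxy p hp).1.1 hpx, hsgn p hp, fun q hq hqx => ?_⟩
    have h1 := hmax q ⟨hq, hqx⟩
    exact ⟨h1, not_lt.1 fun h => absurd ((hW p hp q hq).2 h) h1.not_gt⟩
  · obtain ⟨u, v, hu, hv, h⟩ := exists_lt_sign_eval_eq hd hlc x y
    exact ⟨u, v, hu, hv, h, fun p hp hpx => absurd ⟨p, hp, hpx⟩ hne⟩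

theorem exists_right (hW : IsOrderIso W) (hfin : W.Finite)
    (hlc : SignType.sign f.leadingCoeff = SignType.sign f'.leadingCoeff)
    (hsgn : ∀ p ∈ W, SignType.sign (f.eval p.1) = SignType.sign (f'.eval p.2))
    {x : R} {y : R'} (hxy : SameCell W x y) :
    ∃ u v, x < u ∧ y < v ∧ SignType.sign (f.eval u) = SignType.sign (f'.eval v) ∧
      ∀ p ∈ W, x < p.1 → u ≤ p.1 ∧ v ≤ p.2 := by
  by_cases hne : ({p ∈ W | x < p.1}).Nonempty
  · obtain ⟨p, ⟨hp, hpx⟩, hmax⟩ :=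
      Set.exists_min_image _ Prod.fst (hfin.subset (Set.sep_subset W _)) hne
    refine ⟨p.1, p.2, hpx, (hxy p hp).2.1 hpx, hsgn p hp, fun q hq hqx => ?_⟩
    have h1 := hmax q ⟨hq, hqx⟩
    exact ⟨h1, not_lt.1 fun h => absurd ((hW q hq p hp).2 h) h1.not_gt⟩
  · obtain ⟨u, v, hu, hv, h⟩ := exists_gt_sign_eval_eq hlc x y
    exact ⟨u, v, hu, hv, h, fun p hp hpx => absurd ⟨p, hp, hpx⟩ hne⟩

theorem exists_root_sameCell (hR : PolyIVT R) (hR' : PolyIVT R') (hW : IsOrderIso W)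
    (hfin : W.Finite) (hd : f.natDegree = f'.natDegree)
    (hlc : SignType.sign f.leadingCoeff = SignType.sign f'.leadingCoeff)
    (hsgn : ∀ p ∈ W, SignType.sign (f.eval p.1) = SignType.sign (f'.eval p.2))
    (hroot : ∀ x, f.derivative.eval x = 0 → ∃ p ∈ W, p.1 = x)
    {x : R} (hx : f.eval x = 0) : ∃ y, f'.eval y = 0 ∧ SameCell W x y := by
  by_cases hxW : ∃ p ∈ W, p.1 = x
  · obtain ⟨p, hp, rfl⟩ := hxW
    have := hsgn p hp
    rw [hx, sign_zero, eq_comm, sign_eq_zero_iff] at this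
    exact ⟨p.2, this, hW.sameCell hp⟩
  push Not at hxW
  obtain ⟨y0, hy0⟩ := hW.exists_sameCell hfin x
  obtain ⟨u, v, hux, hvy, huv, hl⟩ := exists_left hW hfin hd hlc hsgn hy0
  obtain ⟨u', v', hux', hvy', huv', hr⟩ := exists_right hW hfin hlc hsgn hy0
  obtain ⟨c, hc, hcd⟩ := hR.mvt f hux
  obtain ⟨c', hc', hcd'⟩ := hR.mvt f hux'
  have hcc : 0 < f.derivative.eval c * f.derivative.eval c' := by
    by_contra! hneg
    obtain ⟨e, he, he0⟩ := hR _ c c' (hc.2.trans hc'.1).le hneg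
    obtain ⟨p, hp, rfl⟩ := hroot e he0
    rcases lt_trichotomy p.1 x with h | h | h
    · exact absurd (hl p hp h).1 (not_le.2 (hc.1.trans_le he.1))
    · exact hxW p hp h
    · exact absurd (hr p hp h).1 (not_le.2 (he.2.trans_lt hc'.2))
  have hneg : f.eval u * f.eval u' < 0 := by
    have h1 := mul_pos hcc (mul_pos (sub_pos.2 hux) (sub_pos.2 hux'))
    rw [hx] at hcd hcd'
    have h2 : f.eval u * f.eval u' = -(f.derivative.eval c * f.derivative.eval c' *
      ((x - u) * (u' - x))) := by
      linear_combination hcd * f.eval u' + f.derivative.eval c * (x - u) * hcd'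
    rw [h2]
    linarith
  have hneg' : f'.eval v * f'.eval v' < 0 := by
    rw [← sign_eq_neg_one_iff, sign_mul, ← huv, ← huv', ← sign_mul, sign_eq_neg_one_iff]
    exact hneg
  obtain ⟨y, hy, hy0⟩ := hR'.exists_root_Ioo (hvy.trans hvy') hneg'
  exact ⟨y, hy0, sameCell_of_lt hxW (fun p hp h => (hl p hp h).2.trans_lt hy.1)
    (fun p hp h => hy.2.trans_le (hr p hp h).2)⟩

theorem not_pos_and_neg_of_sameCell (hR : PolyIVT R) (hR' : PolyIVT R') (hV : IsOrderIso V)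
    (hfin : V.Finite) (hd : f.natDegree = f'.natDegree)
    (hlc : SignType.sign f.leadingCoeff = SignType.sign f'.leadingCoeff)
    (hsgn : ∀ p ∈ V, SignType.sign (f.eval p.1) = SignType.sign (f'.eval p.2))
    (hder : SameSign V f.derivative f'.derivative)
    (hroot : ∀ x, f.eval x = 0 → ∃ p ∈ V, p.1 = x)
    (hroot' : ∀ y, f'.eval y = 0 → ∃ p ∈ V, p.2 = y)
    {x : R} {y : R'} (hxy : SameCell V x y) (hx : 0 < f.eval x) : ¬ f'.eval y < 0 := by
  intro hy
  have hxV : ∀ p ∈ V, p.1 ≠ x := by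
    rintro p hp rfl
    have := hsgn p hp
    rw [(hxy.eq_iff hp).1 rfl, sign_pos hx, sign_neg hy] at this
    exact absurd this (by decide)
  obtain ⟨u, v, hux, hvy, huv, hl⟩ := exists_left hV hfin hd hlc hsgn hxy
  rcases lt_trichotomy (f.eval u) 0 with h | h | h
  · obtain ⟨c, hc, hc0⟩ := hR.exists_root_Ioo hux (mul_neg_of_neg_of_pos h hx)
    obtain ⟨p, hp, rfl⟩ := hroot c hc0
    exact absurd (hl p hp hc.2).1 (not_le.2 hc.1)
  · have hv : f'.eval v = 0 := by rwa [h, sign_zero, eq_comm, sign_eq_zero_iff] at huv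
    obtain ⟨c, hc, hcd⟩ := hR.mvt f hux
    obtain ⟨c', hc', hcd'⟩ := hR'.mvt f' hvy
    rw [h, sub_zero] at hcd
    rw [hv, sub_zero] at hcd'
    have h1 : 0 < f.derivative.eval c :=
      pos_of_mul_pos_left (hcd ▸ hx) (sub_pos.2 hux).le
    have h2 : f'.derivative.eval c' < 0 := by
      by_contra! h3
      have := mul_nonneg h3 (sub_pos.2 hvy).le
      linarith
    have hcell : SameCell V c c' := by
      refine sameCell_of_lt ?_ ?_ ?_
      · rintro p hp rfl
        exact absurd (hl p hp hc.2).1 (not_le.2 hc.1)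
      · intro p hp hpc
        exact ((hl p hp (hpc.trans hc.2)).2).trans_lt hc'.1
      · intro p hp hpc
        rcases lt_trichotomy p.1 x with h | h | h
        · exact absurd (hl p hp h).1 (not_le.2 (hc.1.trans hpc))
        · exact absurd h (hxV p hp)
        · exact hc'.2.trans ((hxy p hp).2.1 h)
    have := hder c c' hcell
    rw [sign_pos h1, sign_neg h2] at this
    exact absurd this (by decide)
  · have hv : 0 < f'.eval v := by rwa [sign_pos h, eq_comm, sign_eq_one_iff] at huv
    obtain ⟨c, hc, hc0⟩ := hR'.exists_root_Ioo hvy (mul_neg_of_pos_of_neg hv hy)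
    obtain ⟨p, hp, rfl⟩ := hroot' c hc0
    exact absurd (hl p hp ((hxy p hp).1.2 hc.2)).2 (not_le.2 hc.1)

/-- A system of corresponding points that is fine enough for the derivative can be refined by the
roots of the polynomial. -/
theorem exists_refinement (hR : PolyIVT R) (hR' : PolyIVT R') (hW : IsOrderIso W)
    (hfin : W.Finite) (hd : f.natDegree = f'.natDegree) (hf : f ≠ 0)
    (hlc : SignType.sign f.leadingCoeff = SignType.sign f'.leadingCoeff)
    (hsgn : ∀ p ∈ W, SignType.sign (f.eval p.1) = SignType.sign (f'.eval p.2))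
    (hder : SameSign W f.derivative f'.derivative)
    (hroot : ∀ x, f.derivative.eval x = 0 → ∃ p ∈ W, p.1 = x)
    (hroot' : ∀ y, f'.derivative.eval y = 0 → ∃ p ∈ W, p.2 = y) :
    ∃ V, W ⊆ V ∧ V.Finite ∧ IsOrderIso V ∧ SameSign V f f' ∧
      (∀ p ∈ V, p ∈ W ∨ f.eval p.1 = 0 ∧ f'.eval p.2 = 0) ∧
      (∀ x, f.eval x = 0 → ∃ p ∈ V, p.1 = x) ∧ (∀ y, f'.eval y = 0 → ∃ p ∈ V, p.2 = y) := by
  have hf' : f' ≠ 0 := by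
    rintro rfl
    rw [Polynomial.leadingCoeff_zero, sign_zero, sign_eq_zero_iff,
      Polynomial.leadingCoeff_eq_zero] at hlc
    exact hf hlc
  set V : Set (R × R') := W ∪ {p | f.eval p.1 = 0 ∧ f'.eval p.2 = 0 ∧ SameCell W p.1 p.2} with hVdef
  have hVfin : V.Finite := by
    refine hfin.union (((f.roots.toFinset ×ˢ f'.roots.toFinset).finite_toSet).subset ?_)
    rintro p ⟨h1, h2, -⟩
    simp [hf, hf', h1, h2]
  have hVr : ∀ x, f.eval x = 0 → ∃ p ∈ V, p.1 = x := fun x hx => by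
    obtain ⟨y, hy, hxy⟩ := exists_root_sameCell hR hR' hW hfin hd hlc hsgn hroot hx
    exact ⟨(x, y), Or.inr ⟨hx, hy, hxy⟩, rfl⟩
  have hVr' : ∀ y, f'.eval y = 0 → ∃ p ∈ V, p.2 = y := fun y hy => by
    obtain ⟨x, hx, hxy⟩ := exists_root_sameCell (W := Prod.swap ⁻¹' W) hR' hR hW.swap
      (hfin.preimage Prod.swap_injective.injOn) hd.symm hlc.symm
      (fun p hp => (hsgn p.swap hp).symm)
      (fun y hy => by
        obtain ⟨p, hp, h⟩ := hroot' y hy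
        exact ⟨p.swap, by simpa using hp, h⟩) hy
    exact ⟨(x, y), Or.inr ⟨hx, hy, hxy.swap⟩, rfl⟩
  have hVsgn : ∀ p ∈ V, SignType.sign (f.eval p.1) = SignType.sign (f'.eval p.2) := by
    rintro p (hp | ⟨h1, h2, -⟩)
    · exact hsgn p hp
    · rw [h1, h2, sign_zero, sign_zero]
  have hV : IsOrderIso V := by
    rintro p (hp | ⟨h1, h2, h3⟩) q (hq | ⟨h1', h2', h3'⟩)
    · exact hW p hp q hq
    · exact (h3' p hp).1
    · exact (h3 q hq).2
    · constructor
      · intro h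
        obtain ⟨c, hc, hc0⟩ := hR.rolle h h1 h1'
        obtain ⟨r, hr, rfl⟩ := hroot c hc0
        exact ((h3 r hr).2.1 hc.1).trans ((h3' r hr).1.1 hc.2)
      · intro h
        obtain ⟨c, hc, hc0⟩ := hR'.rolle h h2 h2'
        obtain ⟨r, hr, rfl⟩ := hroot' c hc0
        exact ((h3 r hr).2.2 hc.1).trans ((h3' r hr).1.2 hc.2)
  have hVder : SameSign V f.derivative f'.derivative :=
    fun x y hxy => hder x y (hxy.mono Set.subset_union_left)
  refine ⟨V, Set.subset_union_left, hVfin, hV, fun x y hxy => ?_, ?_, hVr, hVr'⟩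
  · have hzero : f.eval x = 0 ↔ f'.eval y = 0 := by
      constructor
      · intro h
        obtain ⟨p, hp, rfl⟩ := hVr x h
        have := hVsgn p hp
        rwa [h, sign_zero, eq_comm, sign_eq_zero_iff, (hxy.eq_iff hp).1 rfl] at this
      · intro h
        obtain ⟨p, hp, rfl⟩ := hVr' y h
        have := hVsgn p hp
        rwa [h, sign_zero, sign_eq_zero_iff, (hxy.eq_iff hp).2 rfl] at this
    have h1 := not_pos_and_neg_of_sameCell hR hR' hV hVfin hd hlc hVsgn hVder hVr hVr' hxy
    have h2 := not_pos_and_neg_of_sameCell (f := f') (f' := f) hR' hR hV.swap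
      (hVfin.preimage Prod.swap_injective.injOn) hd.symm hlc.symm
      (fun p hp => (hVsgn p.swap hp).symm) hVder.swap
      (fun y hy => by
        obtain ⟨p, hp, h⟩ := hVr' y hy
        exact ⟨p.swap, by simpa using hp, h⟩)
      (fun x hx => by
        obtain ⟨p, hp, h⟩ := hVr x hx
        exact ⟨p.swap, by simpa using hp, h⟩) hxy.swap
    rcases lt_trichotomy (f.eval x) 0 with h | h | h
    · rcases lt_trichotomy (f'.eval y) 0 with h' | h' | h'
      · rw [sign_neg h, sign_neg h']
      · exact absurd (hzero.2 h') h.ne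
      · exact absurd h (h2 h')
    · rw [h, hzero.1 h, sign_zero, sign_zero]
    · rcases lt_trichotomy (f'.eval y) 0 with h' | h' | h'
      · exact absurd h' (h1 h)
      · exact absurd (hzero.2 h') h.ne'
      · rw [sign_pos h, sign_pos h']
  · rintro p (hp | ⟨h1, h2, -⟩)
    · exact Or.inl hp
    · exact Or.inr ⟨h1, h2⟩

end Cells

section Closure

/-- A finite set can be closed under a degree-lowering binary operation. -/
theorem exists_finset_closed {α : Type*} [DecidableEq α] (deg : α → ℕ) (op : α → α → Finset α)
    (hop : ∀ f g, 0 < deg g → ∀ h ∈ op f g, deg h < deg g) (S : Finset α) :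
    ∃ T, S ⊆ T ∧ ∀ f ∈ T, ∀ g ∈ T, 0 < deg g → deg g ≤ deg f → op f g ⊆ T := by
  have key : ∀ j, ∃ T, S ⊆ T ∧ ∀ f ∈ T, ∀ g ∈ T, 0 < deg g → S.sup deg + 1 ≤ deg g + j →
      deg g ≤ deg f → op f g ⊆ T := by
    intro j
    induction j with
    | zero =>
      exact ⟨S, subset_rfl, fun f _ g hg _ h => absurd (Finset.le_sup (f := deg) hg) (by omega)⟩
    | succ j ih =>
      obtain ⟨T, hST, hT⟩ := ih
      refine ⟨T ∪ ((T ×ˢ T).filter fun p => 0 < deg p.2 ∧ S.sup deg = deg p.2 + j).biUnion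
        fun p => op p.1 p.2, hST.trans subset_union_left, ?_⟩
      have hnew : ∀ f ∈ T ∪ ((T ×ˢ T).filter fun p => 0 < deg p.2 ∧
          S.sup deg = deg p.2 + j).biUnion (fun p => op p.1 p.2),
          S.sup deg ≤ deg f + j → f ∈ T := by
        intro f hf hd
        rcases Finset.mem_union.1 hf with h | h
        · exact h
        · simp only [Finset.mem_biUnion, Finset.mem_filter] at h
          obtain ⟨p, ⟨-, h0, h1⟩, h2⟩ := h
          have := hop _ _ h0 _ h2
          omega
      intro f hf g hg hg0 hgj hgf
      have hgT := hnew g hg (by omega)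
      have hfT := hnew f hf (by omega)
      rcases (show S.sup deg + 1 ≤ deg g + j ∨ S.sup deg = deg g + j by omega) with h | h
      · exact (hT f hfT g hgT hg0 h hgf).trans subset_union_left
      · refine Finset.Subset.trans ?_ subset_union_right
        exact Finset.subset_biUnion_of_mem (fun p : α × α => op p.1 p.2) (x := (f, g))
          (by simp [hfT, hgT, hg0, h])
  obtain ⟨T, h1, h2⟩ := key (S.sup deg + 1)
  exact ⟨T, h1, fun f hf g hg h0 h => h2 f hf g hg h0 (by omega) h⟩

variable {A : Type*} [CommRing A]

theorem exists_pseudo_rem (f g : Polynomial A) (hg : 0 < g.natDegree) :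
    ∃ (k : ℕ) (q r : Polynomial A),
      Polynomial.C (g.leadingCoeff ^ k) * f = g * q + r ∧ r.natDegree < g.natDegree := by
  induction hn : f.natDegree using Nat.strong_induction_on generalizing f with
  | _ n ih =>
  rcases lt_or_ge f.natDegree g.natDegree with h | h
  · exact ⟨0, 0, f, by simp, h⟩
  set f' := Polynomial.C g.leadingCoeff * f -
    Polynomial.C f.leadingCoeff * Polynomial.X ^ (f.natDegree - g.natDegree) * g with hf'
  have hle : f'.natDegree ≤ n := by
    refine (Polynomial.natDegree_sub_le _ _).trans (max_le ?_ ?_)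
    · exact (Polynomial.natDegree_C_mul_le _ _).trans hn.le
    · rw [mul_assoc]
      refine (Polynomial.natDegree_C_mul_le _ _).trans (Polynomial.natDegree_mul_le.trans ?_)
      have := Polynomial.natDegree_X_pow_le (R := A) (f.natDegree - g.natDegree)
      omega
  have hcoeff : f'.coeff n = 0 := by
    have h1 : n = g.natDegree + (f.natDegree - g.natDegree) := by omega
    rw [hf', Polynomial.coeff_sub, Polynomial.coeff_C_mul, mul_assoc, Polynomial.coeff_C_mul,
      mul_comm (Polynomial.X ^ _)]
    nth_rw 2 [h1]
    rw [Polynomial.coeff_mul_X_pow, ← hn]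
    simp only [Polynomial.coeff_natDegree]
    ring
  have hlt : f'.natDegree < n := by
    refine lt_of_le_of_ne hle fun heq => ?_
    rw [← heq, Polynomial.coeff_natDegree, Polynomial.leadingCoeff_eq_zero] at hcoeff
    rw [hcoeff, Polynomial.natDegree_zero] at heq
    omega
  obtain ⟨k, q, r, h1, h2⟩ := ih _ hlt f' rfl
  refine ⟨k + 1, q + Polynomial.C (g.leadingCoeff ^ k) * Polynomial.C f.leadingCoeff *
    Polynomial.X ^ (f.natDegree - g.natDegree), r, ?_, h2⟩
  rw [hf'] at h1
  rw [pow_succ, Polynomial.C_mul]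
  linear_combination h1

theorem exists_even_pseudo_rem (f g : Polynomial A) : ∃ r : Polynomial A,
    0 < g.natDegree → r.natDegree < g.natDegree ∧ ∃ (k : ℕ) (q : Polynomial A),
      Polynomial.C (g.leadingCoeff ^ (2 * k)) * f = g * q + r := by
  by_cases hg : 0 < g.natDegree
  · obtain ⟨k, q, r, h1, h2⟩ := exists_pseudo_rem f g hg
    refine ⟨Polynomial.C (g.leadingCoeff ^ k) * r, fun _ =>
      ⟨(Polynomial.natDegree_C_mul_le _ _).trans_lt h2, k,
        Polynomial.C (g.leadingCoeff ^ k) * q, ?_⟩⟩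
    rw [two_mul, pow_add, Polynomial.C_mul]
    linear_combination Polynomial.C (g.leadingCoeff ^ k) * h1
  · exact ⟨0, fun h => absurd h hg⟩

open Classical in
/-- Every finite set of polynomials is contained in a finite one which is closed under derivatives,
removal of the leading term, and pseudo-remainders with even exponent. -/
theorem exists_finset_closed_polynomial (S : Finset (Polynomial A)) :
    ∃ T, S ⊆ T ∧ (∀ f ∈ T, 0 < f.natDegree → f.eraseLead ∈ T ∧ f.derivative ∈ T) ∧
      ∀ f ∈ T, ∀ g ∈ T, 0 < g.natDegree → g.natDegree ≤ f.natDegree →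
        ∃ r ∈ T, r.natDegree < g.natDegree ∧ ∃ (k : ℕ) (q : Polynomial A),
          Polynomial.C (g.leadingCoeff ^ (2 * k)) * f = g * q + r := by
  choose rem hrem using exists_even_pseudo_rem (A := A)
  obtain ⟨T, hST, hT⟩ := exists_finset_closed Polynomial.natDegree
    (fun f g : Polynomial A => {g.eraseLead, g.derivative, rem f g}) (by
      intro f g hg h hh
      simp only [Finset.mem_insert, Finset.mem_singleton] at hh
      rcases hh with rfl | rfl | rfl
      · have := Polynomial.eraseLead_natDegree_le g
        omega
      · exact Polynomial.natDegree_derivative_lt hg.ne'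
      · exact (hrem f g hg).1) S
  refine ⟨T, hST, fun f hf h0 => ?_, fun f hf g hg h0 hle => ?_⟩
  · have := hT f hf f hf h0 le_rfl
    exact ⟨this (by simp), this (by simp)⟩
  · exact ⟨rem f g, hT f hf g hg h0 hle (by simp), hrem f g h0⟩

end Closure

theorem map_eraseLead_eq {A R : Type*} [CommRing A] [CommRing R] {φ : A →+* R}
    {f : Polynomial A} (h : φ f.leadingCoeff = 0) :
    f.eraseLead.map φ = f.map φ := by
  have := congrArg (Polynomial.map φ) (Polynomial.eraseLead_add_C_mul_X_pow f)
  rw [← this, Polynomial.map_add, Polynomial.map_mul, Polynomial.map_C, h]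
  simp

section Transfer
variable {A R R' : Type*} [CommRing A] [Field R] [LinearOrder R] [Field R'] [LinearOrder R']

/-- `W` is a system of corresponding roots of the polynomials in `G`. -/
structure IsRootSystem (φ : A →+* R) (φ' : A →+* R') (G : Finset (Polynomial A))
    (W : Set (R × R')) : Prop where
  finite : W.Finite
  isOrderIso : IsOrderIso W
  isRoot : ∀ p ∈ W, ∃ g ∈ G, φ g.leadingCoeff ≠ 0 ∧ (g.map φ).eval p.1 = 0 ∧
    (g.map φ').eval p.2 = 0
  sameSign : ∀ g ∈ G, SameSign W (g.map φ) (g.map φ')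
  complete : ∀ g ∈ G, g.map φ ≠ 0 → ∀ x, (g.map φ).eval x = 0 → ∃ p ∈ W, p.1 = x
  complete' : ∀ g ∈ G, g.map φ' ≠ 0 → ∀ y, (g.map φ').eval y = 0 → ∃ p ∈ W, p.2 = y

theorem IsRootSystem.insert_of_same [DecidableEq (Polynomial A)] {φ : A →+* R} {φ' : A →+* R'}
    {G : Finset (Polynomial A)} {W : Set (R × R')} (h : IsRootSystem φ φ' G W) {f : Polynomial A}
    (h1 : SameSign W (f.map φ) (f.map φ'))
    (h2 : f.map φ ≠ 0 → ∀ x, (f.map φ).eval x = 0 → ∃ p ∈ W, p.1 = x)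
    (h3 : f.map φ' ≠ 0 → ∀ y, (f.map φ').eval y = 0 → ∃ p ∈ W, p.2 = y) :
    IsRootSystem φ φ' (insert f G) W where
  finite := h.finite
  isOrderIso := h.isOrderIso
  isRoot p hp := by
    obtain ⟨g, hg, h'⟩ := h.isRoot p hp
    exact ⟨g, Finset.mem_insert_of_mem hg, h'⟩
  sameSign := Finset.forall_mem_insert _ _ _ |>.2 ⟨h1, h.sameSign⟩
  complete := Finset.forall_mem_insert _ _ _ |>.2 ⟨h2, h.complete⟩
  complete' := Finset.forall_mem_insert _ _ _ |>.2 ⟨h3, h.complete'⟩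

variable [IsStrictOrderedRing R] [IsStrictOrderedRing R']

theorem sign_eval_eq_of_pseudo_rem {φ : A →+* R} {f g q r : Polynomial A} {k : ℕ} {x : R}
    (h : Polynomial.C (g.leadingCoeff ^ (2 * k)) * f = g * q + r) (hg : φ g.leadingCoeff ≠ 0)
    (hx : (g.map φ).eval x = 0) :
    SignType.sign ((f.map φ).eval x) = SignType.sign ((r.map φ).eval x) := by
  have := congrArg (fun p => (p.map φ).eval x) h
  simp only [Polynomial.map_mul, Polynomial.map_add, Polynomial.map_C, Polynomial.eval_mul,
    Polynomial.eval_add, Polynomial.eval_C, hx, zero_mul, zero_add] at this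
  rw [← this, sign_mul, map_pow, pow_mul, sign_pos (pow_pos (sq_pos_of_ne_zero hg) k), one_mul]

open Classical in
/-- A root system can be extended by a polynomial of maximal degree. -/
theorem IsRootSystem.exists_insert (hR : PolyIVT R) (hR' : PolyIVT R') {φ : A →+* R}
    {φ' : A →+* R'} {T G : Finset (Polynomial A)}
    (hT : ∀ f ∈ T, 0 < f.natDegree → f.eraseLead ∈ T ∧ f.derivative ∈ T)
    (hT' : ∀ f ∈ T, ∀ g ∈ T, 0 < g.natDegree → g.natDegree ≤ f.natDegree →
        ∃ r ∈ T, r.natDegree < g.natDegree ∧ ∃ (k : ℕ) (q : Polynomial A),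
          Polynomial.C (g.leadingCoeff ^ (2 * k)) * f = g * q + r)
    (hsign : ∀ f ∈ T, SignType.sign (φ f.leadingCoeff) = SignType.sign (φ' f.leadingCoeff))
    (hG : G ⊆ T) {f : Polynomial A} (hf : f ∈ T) (hmax : ∀ g ∈ G, g.natDegree ≤ f.natDegree)
    (hlow : ∀ g ∈ T, g.natDegree < f.natDegree → g ∈ G)
    {W : Set (R × R')} (h : IsRootSystem φ φ' G W) :
    ∃ W', IsRootSystem φ φ' (insert f G) W' := by
  have hs := hsign f hf
  rcases Nat.eq_zero_or_pos f.natDegree with h0 | h0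
  · obtain ⟨a, rfl⟩ := Polynomial.natDegree_eq_zero.1 h0
    refine ⟨W, h.insert_of_same (fun x y _ => ?_) (fun hne x hx => ?_) fun hne x hx => ?_⟩
    · simpa using hs
    · simp only [Polynomial.map_C, Polynomial.eval_C] at hx
      simp [hx] at hne
    · simp only [Polynomial.map_C, Polynomial.eval_C] at hx
      simp [hx] at hne
  obtain ⟨hel, hder⟩ := hT f hf h0
  by_cases hlc : φ f.leadingCoeff = 0
  · have hlc' : φ' f.leadingCoeff = 0 := by
      rwa [hlc, sign_zero, eq_comm, sign_eq_zero_iff] at hs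
    have hm : f.eraseLead ∈ G :=
      hlow _ hel (by have := Polynomial.eraseLead_natDegree_le f; omega)
    have h1 := map_eraseLead_eq hlc
    have h2 := map_eraseLead_eq hlc'
    refine ⟨W, h.insert_of_same ?_ ?_ ?_⟩
    · rw [← h1, ← h2]; exact h.sameSign _ hm
    · rw [← h1]; exact h.complete _ hm
    · rw [← h2]; exact h.complete' _ hm
  have hlc' : φ' f.leadingCoeff ≠ 0 := by
    intro h'
    rw [h', sign_zero, sign_eq_zero_iff] at hs
    exact hlc hs
  have hdm := hlow _ hder (Polynomial.natDegree_derivative_lt h0.ne')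
  have hd1 : (f.map φ).natDegree = f.natDegree :=
    Polynomial.natDegree_map_of_leadingCoeff_ne_zero _ hlc
  have hd2 : (f.map φ').natDegree = f.natDegree :=
    Polynomial.natDegree_map_of_leadingCoeff_ne_zero _ hlc'
  have hl1 : (f.map φ).leadingCoeff = φ f.leadingCoeff :=
    Polynomial.leadingCoeff_map_of_leadingCoeff_ne_zero _ hlc
  have hl2 : (f.map φ').leadingCoeff = φ' f.leadingCoeff :=
    Polynomial.leadingCoeff_map_of_leadingCoeff_ne_zero _ hlc'
  have hn1 : (f.derivative).map φ ≠ 0 := by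
    rw [← Polynomial.derivative_map]
    intro h'
    have := Polynomial.derivative_eq_zero.1 h'
    omega
  have hn2 : (f.derivative).map φ' ≠ 0 := by
    rw [← Polynomial.derivative_map]
    intro h'
    have := Polynomial.derivative_eq_zero.1 h'
    omega
  obtain ⟨V, hWV, hVfin, hV, hVs, hVm, hVr, hVr'⟩ := exists_refinement (f := f.map φ)
    (f' := f.map φ') hR hR' h.isOrderIso h.finite (hd1.trans hd2.symm)
    (by intro h'; rw [h', Polynomial.natDegree_zero] at hd1; omega) (by rw [hl1, hl2, hs])
    (fun p hp => by
      obtain ⟨g, hg, hglc, hg1, hg2⟩ := h.isRoot p hp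
      have hglc' : φ' g.leadingCoeff ≠ 0 := by
        intro h'
        have := hsign g (hG hg)
        rw [h', sign_zero, sign_eq_zero_iff] at this
        exact hglc this
      have hgd : 0 < g.natDegree := by
        rw [Nat.pos_iff_ne_zero]
        intro h'
        obtain ⟨a, rfl⟩ := Polynomial.natDegree_eq_zero.1 h'
        simp at hg1 hglc
        exact hglc hg1
      obtain ⟨r, hrT, hrd, k, q, hrem⟩ := hT' f hf g (hG hg) hgd (hmax g hg)
      rw [sign_eval_eq_of_pseudo_rem hrem hglc hg1, sign_eval_eq_of_pseudo_rem hrem hglc' hg2]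
      exact h.sameSign r (hlow r hrT (hrd.trans_le (hmax g hg))) _ _ (h.isOrderIso.sameCell hp))
    (by rw [Polynomial.derivative_map, Polynomial.derivative_map]; exact h.sameSign _ hdm)
    (by rw [Polynomial.derivative_map]; exact h.complete _ hdm hn1)
    (by rw [Polynomial.derivative_map]; exact h.complete' _ hdm hn2)
  refine ⟨V, hVfin, hV, fun p hp => ?_, Finset.forall_mem_insert _ _ _ |>.2 ⟨hVs, fun g hg x y hxy =>
    h.sameSign g hg x y (hxy.mono hWV)⟩, Finset.forall_mem_insert _ _ _ |>.2 ⟨fun _ => hVr,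
    fun g hg h1 x hx => ?_⟩, Finset.forall_mem_insert _ _ _ |>.2 ⟨fun _ => hVr',
    fun g hg h1 x hx => ?_⟩⟩
  · rcases hVm p hp with h1 | ⟨h1, h2⟩
    · obtain ⟨g, hg, h'⟩ := h.isRoot p h1
      exact ⟨g, Finset.mem_insert_of_mem hg, h'⟩
    · exact ⟨f, Finset.mem_insert_self _ _, hlc, h1, h2⟩
  · obtain ⟨p, hp, h'⟩ := h.complete g hg h1 x hx
    exact ⟨p, hWV hp, h'⟩
  · obtain ⟨p, hp, h'⟩ := h.complete' g hg h1 x hx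
    exact ⟨p, hWV hp, h'⟩

/-- Signs of finitely many polynomials in one variable can be transferred between fields with the
intermediate value property, as soon as the signs of finitely many coefficients agree. -/
theorem exists_finset_transfer (S : Finset (Polynomial A)) : ∃ S' : Finset A,
    ∀ {R R' : Type} [Field R] [LinearOrder R] [IsStrictOrderedRing R] [Field R'] [LinearOrder R']
      [IsStrictOrderedRing R'], PolyIVT R → PolyIVT R' → ∀ (φ : A →+* R) (φ' : A →+* R'),
      (∀ a ∈ S', SignType.sign (φ a) = SignType.sign (φ' a)) → ∀ x : R, ∃ y : R', ∀ f ∈ S,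
        SignType.sign ((f.map φ).eval x) = SignType.sign ((f.map φ').eval y) := by
  classical
  obtain ⟨T, hST, hT, hT'⟩ := exists_finset_closed_polynomial S
  refine ⟨T.image Polynomial.leadingCoeff, ?_⟩
  intro R R' _ _ _ _ _ _ hR hR' φ φ' hsign x
  have key : ∀ G : Finset (Polynomial A), G ⊆ T →
      (∀ f ∈ G, ∀ g ∈ T, g.natDegree < f.natDegree → g ∈ G) →
      ∃ W, IsRootSystem φ φ' G W := by
    intro G
    refine Finset.induction_on_max_value Polynomial.natDegree G ?_ ?_
    · exact fun _ _ => ⟨∅, Set.finite_empty, by simp [IsOrderIso], by simp, by simp,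
        by simp, by simp⟩
    · intro f G hfG hmax ih hG hlow
      rw [Finset.insert_subset_iff] at hG
      have hlow' : ∀ g ∈ T, g.natDegree < f.natDegree → g ∈ G := fun g hg hlt => by
        rcases Finset.mem_insert.1 (hlow f (Finset.mem_insert_self _ _) g hg hlt) with h | h
        · rw [h] at hlt; omega
        · exact h
      obtain ⟨W, hW⟩ := ih hG.2 fun g hg g' hg' hlt =>
        hlow' g' hg' (hlt.trans_le (hmax g hg))
      exact hW.exists_insert hR hR' hT hT'
        (fun f hf => hsign _ (Finset.mem_image_of_mem _ hf)) hG.2 hG.1 hmax hlow'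
  obtain ⟨W, hW⟩ := key T subset_rfl fun _ _ g hg _ => hg
  obtain ⟨y, hy⟩ := hW.isOrderIso.exists_sameCell hW.finite x
  exact ⟨y, fun f hf => hW.sameSign f (hST hf) x y hy⟩

end Transfer

theorem polyIVT_real : PolyIVT ℝ := by
  intro f a b hab h
  have hc : ContinuousOn (fun x => f.eval x) (Set.Icc a b) := f.continuous.continuousOn
  rcases le_total (f.eval a) 0 with ha | ha
  · rcases ha.eq_or_lt with ha | ha
    · exact ⟨a, ⟨le_rfl, hab⟩, ha⟩
    · have hb : 0 ≤ f.eval b := by by_contra! hb; nlinarith [mul_pos_of_neg_of_neg ha hb]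
      exact intermediate_value_Icc hab hc ⟨ha.le, hb⟩
  · rcases ha.eq_or_lt with ha | ha
    · exact ⟨a, ⟨le_rfl, hab⟩, ha.symm⟩
    · have hb : f.eval b ≤ 0 := by by_contra! hb; nlinarith [mul_pos ha hb]
      exact intermediate_value_Icc' hab hc ⟨hb, ha.le⟩

/-- Sign conditions on finitely many real polynomials which are satisfied in an extension field
with the intermediate value property are satisfied by a real point. -/
theorem exists_real_point {L : Type} [Field L] [LinearOrder L] [IsStrictOrderedRing L]
    (hL : PolyIVT L) (n : ℕ) (S : Finset (MvPolynomial (Fin n) ℝ))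
    (φ : MvPolynomial (Fin n) ℝ →+* L) :
    ∃ b : Fin n → ℝ, ∀ f ∈ S, SignType.sign (φ f) = SignType.sign (eval b f) := by
  classical
  induction n with
  | zero =>
    refine ⟨Fin.elim0, fun f _ => ?_⟩
    obtain ⟨r, rfl⟩ := MvPolynomial.C_surjective (Fin 0) f
    have hpos : ∀ s : ℝ, 0 < s → 0 < φ (C s) := fun s hs => by
      rw [← Real.sq_sqrt hs.le, map_pow, map_pow]
      have : φ (C (Real.sqrt s)) ≠ 0 := by
        have := (φ.comp C).injective.ne (Real.sqrt_pos.2 hs).ne'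
        simpa using this
      positivity
    rw [eval_C]
    rcases lt_trichotomy r 0 with h | h | h
    · have := hpos (-r) (by linarith)
      rw [map_neg, map_neg] at this
      rw [sign_neg h, sign_neg (by linarith)]
    · simp [h]
    · rw [sign_pos h, sign_pos (hpos r h)]
  | succ n ih =>
    obtain ⟨S', hS'⟩ := exists_finset_transfer (S.image (finSuccEquiv ℝ n))
    set ψ : Polynomial (MvPolynomial (Fin n) ℝ) →+* L :=
      φ.comp (finSuccEquiv ℝ n).symm.toRingEquiv.toRingHom with hψ
    obtain ⟨b, hb⟩ := ih S' (ψ.comp Polynomial.C)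
    obtain ⟨y, hy⟩ := hS' hL polyIVT_real (ψ.comp Polynomial.C) (eval b) hb (ψ Polynomial.X)
    refine ⟨Fin.cons y b, fun f hf => ?_⟩
    rw [eval_eq_eval_mv_eval', ← hy _ (Finset.mem_image_of_mem _ hf)]
    congr 1
    have : ∀ P, (Polynomial.map (ψ.comp Polynomial.C) P).eval (ψ Polynomial.X) = ψ P := by
      intro P
      rw [Polynomial.eval_map]
      have : Polynomial.eval₂RingHom (ψ.comp Polynomial.C) (ψ Polynomial.X) = ψ :=
        Polynomial.ringHom_ext' (by ext <;> simp) (by simp)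
      exact congrArg (fun h : _ →+* L => h P) this
    rw [this]
    simp [hψ]

/-- The preordering generated by `T` and `g`. -/
theorem IsPreord.adjoin {B : Type*} [CommRing B] {T : Set B} (hT : IsPreord T) (g : B) :
    IsPreord {s | ∃ a ∈ T, ∃ b ∈ T, s = a + b * g} where
  add_mem := by
    rintro _ _ ⟨a, ha, b, hb, rfl⟩ ⟨a', ha', b', hb', rfl⟩
    exact ⟨a + a', hT.add_mem ha ha', b + b', hT.add_mem hb hb', by ring⟩
  mul_mem := by
    rintro _ _ ⟨a, ha, b, hb, rfl⟩ ⟨a', ha', b', hb', rfl⟩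
    exact ⟨a * a' + b * b' * g ^ 2, hT.add_mem (hT.mul_mem ha ha')
      (hT.mul_mem (hT.mul_mem hb hb') (hT.sq_mem g)), a * b' + a' * b,
      hT.add_mem (hT.mul_mem ha hb') (hT.mul_mem ha' hb), by ring⟩
  sq_mem s := ⟨s ^ 2, hT.sq_mem s, 0, hT.zero_mem, by ring⟩

theorem exists_nonneg_of_neg_one_notMem {n : ℕ} {T : Set (MvPolynomial (Fin n) ℝ)}
    (hT : IsPreord T) (h1 : -1 ∉ T) {g h : MvPolynomial (Fin n) ℝ} (hg : g ∈ T) (hh : h ∈ T) :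
    ∃ x, 0 ≤ eval x g ∧ 0 ≤ eval x h := by
  classical
  obtain ⟨L, _, _, _, φ, hL, hφ⟩ := exists_orderedField hT h1
  obtain ⟨x, hx⟩ := exists_real_point hL n {g, h} φ
  have key : ∀ f ∈ ({g, h} : Finset (MvPolynomial (Fin n) ℝ)), f ∈ T → 0 ≤ eval x f := by
    intro f hf hfT
    rw [← sign_nonneg_iff, ← hx f hf, sign_nonneg_iff]
    exact hφ f hfT
  exact ⟨x, key g (by simp) hg, key h (by simp) hh⟩

/-- A quadratic module of polynomials containing some `q` with compact nonnegativity set contains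
`R - ∑ xᵢ²` for some `R`. -/
theorem exists_ball_mem {n : ℕ} {M : Set (MvPolynomial (Fin n) ℝ)}
    (hM : IsConeModule {s | IsSumSq s} M) {q : MvPolynomial (Fin n) ℝ} (hq : q ∈ M)
    (hc : IsCompact {x : Fin n → ℝ | 0 ≤ eval x q}) :
    ∃ R : ℝ, C R - ∑ i, (X i : MvPolynomial (Fin n) ℝ) ^ 2 ∈ M := by
  set N : MvPolynomial (Fin n) ℝ := ∑ i, X i ^ 2 with hN
  obtain ⟨R, hR0, hR⟩ : ∃ R : ℝ, 0 ≤ R ∧ ∀ x, 0 ≤ eval x q → eval x N < R := by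
    obtain ⟨B, hB⟩ := hc.bddAbove_image (f := fun x => eval x N) (continuous_eval N).continuousOn
    refine ⟨max B 0 + 1, by positivity, fun x hx => ?_⟩
    have := hB ⟨x, hx, rfl⟩
    exact (this.trans (le_max_left _ _)).trans_lt (lt_add_one _)
  have hS := isPreord_sumSq (MvPolynomial (Fin n) ℝ)
  have hT := hS.adjoin q
  set T := {s | ∃ a ∈ {s : MvPolynomial (Fin n) ℝ | IsSumSq s},
    ∃ b ∈ {s : MvPolynomial (Fin n) ℝ | IsSumSq s}, s = a + b * q} with hTdef
  have hTM : T ⊆ M := by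
    rintro _ ⟨a, ha, b, hb, rfl⟩
    exact hM.add_mem (hM.subset ha) (hM.mul_mem hb hq)
  have hqT : q ∈ T := ⟨0, hS.zero_mem, 1, hS.one_mem, by ring⟩
  have hNT : N ∈ T := by
    refine ⟨N, ?_, 0, hS.zero_mem, by ring⟩
    exact IsSumSq.sum fun i _ => hS.sq_mem (X i)
  obtain ⟨s0, hs0, s1, hs1, h1⟩ : ∃ s0 ∈ T, ∃ s1 ∈ T, -1 = s0 + s1 * (N - C R) := by
    by_contra hcon
    obtain ⟨x, hx, hx'⟩ := exists_nonneg_of_neg_one_notMem (hT.adjoin (N - C R)) hcon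
      (g := q) (h := N - C R) ⟨q, hqT, 0, hT.zero_mem, by ring⟩
      ⟨0, hT.zero_mem, 1, hT.one_mem, by ring⟩
    have := hR x hx
    simp only [map_sub, eval_C] at hx'
    linarith
  have hball : (1 + s0) * (C R - N) ∈ T := by
    have : (1 + s0) * (C R - N) = s1 * (C R - N) ^ 2 := by linear_combination (N - C R) * h1
    rw [this]
    exact hT.mul_mem hs1 (hT.sq_mem _)
  have hT0 := hT.adjoin (C R - N)
  obtain ⟨B, t1, ht1, t2, ht2, h2⟩ := archimedean_of_ball hT0 hT0.isConeModule (R := R)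
    ⟨0, hT.zero_mem, 1, hT.one_mem, by rw [hN]; ring⟩ s0
  rw [algebraMap_eq] at h2
  have hs : (1 + s0) * (C B - s0) ∈ T := by
    have : (1 + s0) * (C B - s0) = (1 + s0) * t1 + t2 * ((1 + s0) * (C R - N)) := by rw [h2]; ring
    rw [this]
    exact hT.add_mem (hT.mul_mem (hT.add_mem hT.one_mem hs0) ht1) (hT.mul_mem ht2 hball)
  have hC : C (B + B ^ 2 / 4) - s0 ∈ T := by
    have : (C (B + B ^ 2 / 4) - s0 : MvPolynomial (Fin n) ℝ) =
        (1 + s0) * (C B - s0) + (s0 - C (B / 2)) ^ 2 := by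
      have e1 : (C B : MvPolynomial (Fin n) ℝ) = 2 * C (B / 2) := by
        rw [show (2 : MvPolynomial (Fin n) ℝ) = C 2 from (map_ofNat C 2).symm, ← C_mul]
        congr 1; ring
      have e2 : (C (B + B ^ 2 / 4) : MvPolynomial (Fin n) ℝ) = C B + C (B / 2) ^ 2 := by
        rw [← C_pow, ← C_add]; congr 1; ring
      rw [e2, e1]; ring
    rw [this]
    exact hT.add_mem hs (hT.sq_mem _)
  refine ⟨R * (B + B ^ 2 / 4) + R, hTM ?_⟩
  have : (C (R * (B + B ^ 2 / 4) + R) - N : MvPolynomial (Fin n) ℝ) =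
      C R * (C (B + B ^ 2 / 4) - s0) + (1 + s0) * (C R - N) + s0 * N := by
    rw [C_add, C_mul]; ring
  rw [this]
  exact hT.add_mem (hT.add_mem (hT.mul_mem (hT.real_mem hR0) hC) hball) (hT.mul_mem hs0 hNT)

section Riesz
variable {n : ℕ}

/-- The Riesz functional `x^α ↦ y_α`. -/
def riesz (y : (Fin n →₀ ℕ) → ℝ) : MvPolynomial (Fin n) ℝ →ₗ[ℝ] ℝ :=
  (basisMonomials (Fin n) ℝ).constr ℝ y

theorem riesz_monomial (y : (Fin n →₀ ℕ) → ℝ) (α : Fin n →₀ ℕ) (r : ℝ) :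
    riesz y (monomial α r) = r * y α := by
  have h := (basisMonomials (Fin n) ℝ).constr_basis ℝ y α
  rw [coe_basisMonomials] at h
  rw [← mul_one r, ← smul_eq_mul r 1, ← smul_monomial, map_smul, riesz, h, smul_eq_mul,
    smul_eq_mul, mul_one]

theorem sum_coeff_mul (L : MvPolynomial (Fin n) ℝ →ₗ[ℝ] ℝ) (q : MvPolynomial (Fin n) ℝ) :
    ∑ α ∈ q.support, q.coeff α * L (monomial α 1) = L q := by
  conv_rhs => rw [← support_sum_monomial_coeff q]
  rw [map_sum]
  refine Finset.sum_congr rfl fun α _ => ?_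
  rw [← smul_eq_mul, ← map_smul, smul_monomial, smul_eq_mul, mul_one]

theorem pairing_eq_riesz (q : MvPolynomial (Fin n) ℝ) (y : (Fin n →₀ ℕ) → ℝ) :
    pairing q y = riesz y q := by
  rw [← sum_coeff_mul, pairing]
  simp [riesz_monomial]

theorem sum_sum_coeff_mul (L : MvPolynomial (Fin n) ℝ →ₗ[ℝ] ℝ) (q : MvPolynomial (Fin n) ℝ) :
    ∑ α ∈ q.support, ∑ β ∈ q.support, q.coeff α * q.coeff β * L (monomial (α + β) 1) =
      L (q ^ 2) := by
  have h1 : ∀ α, ∑ β ∈ q.support, q.coeff β * L (monomial (α + β) 1) =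
      L (monomial α 1 * q) := fun α => by
    rw [← LinearMap.mulLeft_apply (R := ℝ), ← LinearMap.comp_apply, ← sum_coeff_mul]
    simp [monomial_mul]
  simp_rw [mul_assoc, ← Finset.mul_sum, h1]
  have := sum_coeff_mul (L ∘ₗ LinearMap.mulRight ℝ q) q
  simpa [sq] using this

theorem locEntry_eq_riesz (c : MvPolynomial (Fin n) ℝ) (y : (Fin n →₀ ℕ) → ℝ)
    (α β : Fin n →₀ ℕ) : locEntry c y α β = riesz y (monomial (α + β) 1 * c) := by
  have := sum_coeff_mul (riesz y ∘ₗ LinearMap.mulLeft ℝ (monomial (α + β) 1)) c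
  simp only [LinearMap.comp_apply, LinearMap.mulLeft_apply] at this
  rw [← this, locEntry]
  refine Finset.sum_congr rfl fun γ _ => ?_
  rw [monomial_mul, riesz_monomial, mul_one, one_mul, add_assoc, add_comm γ]

theorem sum_sum_locEntry (c q : MvPolynomial (Fin n) ℝ) (y : (Fin n →₀ ℕ) → ℝ) :
    ∑ α ∈ q.support, ∑ β ∈ q.support, q.coeff α * q.coeff β * locEntry c y α β =
      riesz y (q ^ 2 * c) := by
  simp_rw [locEntry_eq_riesz]
  exact sum_sum_coeff_mul (riesz y ∘ₗ LinearMap.mulRight ℝ c) q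

theorem sum_sum_moment (q : MvPolynomial (Fin n) ℝ) (y : (Fin n →₀ ℕ) → ℝ) :
    ∑ α ∈ q.support, ∑ β ∈ q.support, q.coeff α * q.coeff β * y (α + β) =
      riesz y (q ^ 2) := by
  rw [← sum_sum_coeff_mul]
  simp [riesz_monomial]

theorem mdeg_le_totalDegree {q : MvPolynomial (Fin n) ℝ} {α : Fin n →₀ ℕ} (h : α ∈ q.support) :
    mdeg α ≤ q.totalDegree := by
  have := le_totalDegree h
  rwa [Finsupp.sum_fintype _ _ fun _ => rfl] at this

end Riesz

section Feasible
variable {n : ℕ} {Eqs Ineqs : Set (MvPolynomial (Fin n) ℝ)}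

/-- `q` is nonnegative on all feasible points of all sufficiently high relaxations. -/
def EventuallyNonneg (Eqs Ineqs : Set (MvPolynomial (Fin n) ℝ)) (q : MvPolynomial (Fin n) ℝ) :
    Prop :=
  ∀ᶠ k in atTop, ∀ y, momFeasible Eqs Ineqs k y → 0 ≤ riesz y q

namespace EventuallyNonneg

theorem zero : EventuallyNonneg Eqs Ineqs 0 := Eventually.of_forall fun k y _ => by simp

theorem add {f g : MvPolynomial (Fin n) ℝ} (hf : EventuallyNonneg Eqs Ineqs f)
    (hg : EventuallyNonneg Eqs Ineqs g) : EventuallyNonneg Eqs Ineqs (f + g) := by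
  filter_upwards [hf, hg] with k h1 h2 y hy
  rw [map_add]
  exact add_nonneg (h1 y hy) (h2 y hy)

theorem sum {α : Type*} (s : Finset α) {f : α → MvPolynomial (Fin n) ℝ}
    (h : ∀ j ∈ s, EventuallyNonneg Eqs Ineqs (f j)) :
    EventuallyNonneg Eqs Ineqs (∑ j ∈ s, f j) :=
  Finset.sum_induction _ _ (fun _ _ => add) zero h

theorem sos {σ : MvPolynomial (Fin n) ℝ} (hσ : IsSOSPoly σ) : EventuallyNonneg Eqs Ineqs σ := by
  obtain ⟨t, r, rfl⟩ := hσ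
  refine sum _ fun j _ => ?_
  filter_upwards [eventually_ge_atTop (r j).totalDegree] with k hk y hy
  rw [← sum_sum_moment]
  exact hy.2.1 _ hk

theorem sos_mul {σ c : MvPolynomial (Fin n) ℝ} (hσ : IsSOSPoly σ) (hc : c ∈ Ineqs) :
    EventuallyNonneg Eqs Ineqs (σ * c) := by
  obtain ⟨t, r, rfl⟩ := hσ
  rw [Finset.sum_mul]
  refine sum _ fun j _ => ?_
  filter_upwards [eventually_ge_atTop ((r j).totalDegree + ceilHalf c.totalDegree)] with k hk y hy
  rw [← sum_sum_locEntry]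
  exact hy.2.2.2 c hc _ (by omega)

theorem mul_eq (h : MvPolynomial (Fin n) ℝ) {c : MvPolynomial (Fin n) ℝ} (hc : c ∈ Eqs) :
    EventuallyNonneg Eqs Ineqs (h * c) := by
  filter_upwards [eventually_ge_atTop (h.totalDegree + ceilHalf c.totalDegree)] with k hk y hy
  refine le_of_eq ?_
  have h1 := sum_coeff_mul (riesz y ∘ₗ LinearMap.mulRight ℝ c) h
  simp only [LinearMap.comp_apply, LinearMap.mulRight_apply] at h1
  rw [← h1, eq_comm]
  refine Finset.sum_eq_zero fun α hα => ?_
  have h2 := hy.2.2.1 c hc α 0 (by have := mdeg_le_totalDegree hα; omega) (by simp [mdeg])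
  rw [locEntry_eq_riesz, add_zero] at h2
  rw [h2, mul_zero]

theorem of_mem_idealQM {ι : Type*} {E I : Finset ι} {c : ι → MvPolynomial (Fin n) ℝ}
    {q : MvPolynomial (Fin n) ℝ} (hq : q ∈ idealQM E I c) :
    EventuallyNonneg (c '' ↑E) (c '' ↑I) q := by
  obtain ⟨h, σ0, σ, h0, hσ, rfl⟩ := hq
  refine ((sum _ fun j hj => mul_eq _ ?_).add (sos h0)).add
    (sum _ fun j hj => sos_mul (hσ j hj) ?_)
  exacts [⟨j, hj, rfl⟩, ⟨j, hj, rfl⟩]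

end EventuallyNonneg

/-- Conic combinations of point evaluations give feasible points of every relaxation. -/
theorem momFeasible_of_points {ι : Type*} {E I : Finset ι} {c : ι → MvPolynomial (Fin n) ℝ}
    {l : ℕ} {lam : Fin l → ℝ} {v : Fin l → Fin n → ℝ} {y : (Fin n →₀ ℕ) → ℝ}
    (hlam : ∀ j, 0 ≤ lam j)
    (hE : ∀ j, ∀ i ∈ E, eval (v j) (c i) = 0) (hI : ∀ j, ∀ i ∈ I, 0 ≤ eval (v j) (c i))
    (hy : ∀ q, riesz y q = ∑ j, lam j * eval (v j) q) (hy0 : y 0 = 1) (k : ℕ) :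
    momFeasible (c '' ↑E) (c '' ↑I) k y := by
  refine ⟨hy0, fun q _ => ?_, ?_, ?_⟩
  · rw [sum_sum_moment, hy]
    exact Finset.sum_nonneg fun j _ => mul_nonneg (hlam j) (by rw [map_pow]; positivity)
  · rintro _ ⟨i, hi, rfl⟩ α β _ _
    rw [locEntry_eq_riesz, hy]
    exact Finset.sum_eq_zero fun j _ => by rw [map_mul, hE j i hi, mul_zero, mul_zero]
  · rintro _ ⟨i, hi, rfl⟩ q _
    rw [sum_sum_locEntry, hy]
    refine Finset.sum_nonneg fun j _ => mul_nonneg (hlam j) ?_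
    rw [map_mul, map_pow]
    exact mul_nonneg (sq_nonneg _) (hI j i hi)

theorem riesz_points {l : ℕ} (lam : Fin l → ℝ) (v : Fin l → Fin n → ℝ)
    (q : MvPolynomial (Fin n) ℝ) :
    riesz (fun α => ∑ j, lam j * ∏ i, v j i ^ α i) q = ∑ j, lam j * eval (v j) q := by
  induction q using MvPolynomial.induction_on' with
  | monomial α r =>
    rw [riesz_monomial, Finset.mul_sum]
    refine Finset.sum_congr rfl fun j _ => ?_
    rw [eval_monomial, Finsupp.prod_fintype _ _ fun _ => pow_zero _]
    ring
  | add q r hq hr => simp only [map_add, hq, hr, mul_add, Finset.sum_add_distrib]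

end Feasible

section Putinar
variable {n : ℕ} {ι : Type*} {E I : Finset ι} {c : ι → MvPolynomial (Fin n) ℝ}

theorem isSOSPoly_of_isSumSq {s : MvPolynomial (Fin n) ℝ} (hs : IsSumSq s) : IsSOSPoly s := by
  induction hs with
  | zero => exact ⟨0, 0, by simp⟩
  | sq_add a _ ih =>
    obtain ⟨t, r, rfl⟩ := ih
    exact ⟨t + 1, Fin.cons a r, by simp [Fin.sum_univ_succ, sq]⟩

theorem IsSOSPoly.isSumSq {s : MvPolynomial (Fin n) ℝ} (hs : IsSOSPoly s) : IsSumSq s := by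
  obtain ⟨t, r, rfl⟩ := hs
  exact IsSumSq.sum fun j _ => (isPreord_sumSq _).sq_mem (r j)

theorem isConeModule_idealQM : IsConeModule {s | IsSumSq s} (idealQM E I c) where
  one_mem := ⟨0, 1, 0, isSOSPoly_of_isSumSq (isPreord_sumSq _).one_mem,
    fun _ _ => isSOSPoly_of_isSumSq .zero, by simp⟩
  add_mem := by
    rintro _ _ ⟨h, σ0, σ, h0, hσ, rfl⟩ ⟨h', σ0', σ', h0', hσ', rfl⟩
    refine ⟨h + h', σ0 + σ0', σ + σ', isSOSPoly_of_isSumSq (h0.isSumSq.add h0'.isSumSq),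
      fun j hj => isSOSPoly_of_isSumSq ((hσ j hj).isSumSq.add (hσ' j hj).isSumSq), ?_⟩
    simp only [Pi.add_apply, add_mul, Finset.sum_add_distrib]
    ring
  mul_mem := by
    rintro s _ hs ⟨h, σ0, σ, h0, hσ, rfl⟩
    refine ⟨fun j => s * h j, s * σ0, fun j => s * σ j,
      isSOSPoly_of_isSumSq (IsSumSq.mul hs h0.isSumSq),
      fun j hj => isSOSPoly_of_isSumSq (IsSumSq.mul hs (hσ j hj).isSumSq), ?_⟩
    simp only [mul_add, Finset.mul_sum, mul_assoc]

theorem mul_mem_idealQM [DecidableEq ι] {j : ι} (hj : j ∈ E) (f : MvPolynomial (Fin n) ℝ) :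
    f * c j ∈ idealQM E I c :=
  ⟨Pi.single j f, 0, 0, isSOSPoly_of_isSumSq .zero, fun _ _ => isSOSPoly_of_isSumSq .zero, by
    simp [Pi.single_apply, hj]⟩

theorem mem_idealQM [DecidableEq ι] {j : ι} (hj : j ∈ I) : c j ∈ idealQM E I c :=
  ⟨0, 0, Pi.single j 1, isSOSPoly_of_isSumSq .zero, fun i _ => isSOSPoly_of_isSumSq (by
    rw [Pi.single_apply]
    split_ifs
    exacts [(isPreord_sumSq _).one_mem, .zero]), by simp [Pi.single_apply, hj]⟩

/-- Putinar's Positivstellensatz. -/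
theorem mem_idealQM_of_pos [DecidableEq ι]
    (hArch : ∃ q ∈ idealQM E I c, IsCompact {x : Fin n → ℝ | 0 ≤ eval x q})
    {f : MvPolynomial (Fin n) ℝ}
    (hf : ∀ x, (∀ j ∈ E, eval x (c j) = 0) → (∀ j ∈ I, 0 ≤ eval x (c j)) → 0 < eval x f) :
    f ∈ idealQM E I c := by
  obtain ⟨q, hq, hc⟩ := hArch
  have hM := isConeModule_idealQM (E := E) (I := I) (c := c)
  have hT := isPreord_sumSq (MvPolynomial (Fin n) ℝ)
  obtain ⟨R, hR⟩ := exists_ball_mem hM hq hc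
  refine mem_of_pos_of_archimedean hT hM (archimedean_of_ball hT hM hR) fun φ hφ => ?_
  have he : ∀ g, φ g = eval (fun i => φ (X i)) g := fun g => by
    rw [← coe_aeval_eq_eval, RingHom.coe_coe]
    exact DFunLike.congr_fun (aeval_unique φ) g
  rw [he]
  refine hf _ (fun j hj => ?_) fun j hj => ?_
  · have h1 := hφ _ (mul_mem_idealQM hj 1)
    have h2 := hφ _ (mul_mem_idealQM hj (-1))
    rw [← he]
    simp only [one_mul, neg_mul, map_neg] at h1 h2
    linarith
  · rw [← he]
    exact hφ _ (mem_idealQM hj)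

end Putinar

section Bounds
variable {n m : ℕ}

theorem mul_elog_le {a t b : ℝ} (ha : 0 < a) (h : t ≤ Real.exp (b / a)) :
    (a : EReal) * elog t ≤ (b : EReal) := by
  unfold elog
  split_ifs with ht
  · rw [← EReal.coe_mul, EReal.coe_le_coe_iff, mul_comm, ← le_div_iff₀ ha]
    exact (Real.log_le_iff_le_exp ht).2 h
  · rw [EReal.coe_mul_bot_of_pos ha]
    exact bot_le

theorem le_exp_of_mul_elog_le {a t b : ℝ} (ha : 0 < a)
    (h : (a : EReal) * elog t ≤ (b : EReal)) : t ≤ Real.exp (b / a) := by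
  unfold elog at h
  split_ifs at h with ht
  · rw [← EReal.coe_mul, EReal.coe_le_coe_iff, mul_comm, ← le_div_iff₀ ha] at h
    exact (Real.log_le_iff_le_exp ht).1 h
  · exact (not_lt.1 ht).trans (Real.exp_pos _).le

theorem coe_sum_ereal {α : Type*} (s : Finset α) (f : α → ℝ) :
    ((∑ i ∈ s, f i : ℝ) : EReal) = ∑ i ∈ s, (f i : EReal) :=
  map_sum (⟨⟨Real.toEReal, rfl⟩, EReal.coe_add⟩ : ℝ →+ EReal) f s

/-- Each feasible value of the moment problem is attained in every relaxation. -/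
theorem fMom_le_fMomK {ι : Type*} {E I : Finset ι} {c : ι → MvPolynomial (Fin n) ℝ}
    {K : Set (Fin n → ℝ)}
    (hK : K = {x | (∀ j ∈ E, eval x (c j) = 0) ∧ ∀ j ∈ I, 0 ≤ eval x (c j)})
    (a : Fin m → ℝ) (p : Fin m → MvPolynomial (Fin n) ℝ) {d : ℕ}
    (hd : ∀ i, (p i).totalDegree ≤ 2 * d) (k : ℕ) :
    fMom d a p K ≤ fMomK a p (c '' ↑E) (c '' ↑I) k := by
  refine sSup_le ?_
  rintro _ ⟨z, ⟨⟨l, lam, v, hlam, hv, rfl⟩, hz0⟩, rfl⟩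
  subst hK
  refine le_sSup ⟨fun α => ∑ j, lam j * ∏ i, v j i ^ α i, ?_, ?_⟩
  · refine momFeasible_of_points hlam (fun j => (hv j).1) (fun j => (hv j).2)
      (riesz_points lam v) ?_ k
    simpa [monoVec, mdeg] using hz0
  · refine Finset.sum_congr rfl fun i _ => ?_
    congr 2
    refine Finset.sum_congr rfl fun α hα => ?_
    have : mdeg α ≤ 2 * d := (mdeg_le_totalDegree hα).trans (hd i)
    simp [monoVec, this]

theorem eventually_fMomK_le {ι : Type*} [DecidableEq ι] {E I : Finset ι}
    {c : ι → MvPolynomial (Fin n) ℝ} {K : Set (Fin n → ℝ)}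
    (hK : K = {x | (∀ j ∈ E, eval x (c j) = 0) ∧ ∀ j ∈ I, 0 ≤ eval x (c j)})
    {a : Fin m → ℝ} (ha : ∀ i, 0 < a i) {p : Fin m → MvPolynomial (Fin n) ℝ}
    (hArch : ∃ q ∈ idealQM E I c, IsCompact {x : Fin n → ℝ | 0 ≤ eval x q})
    {γ : Fin m → ℝ}
    (hγ : ∀ i, ∀ x ∈ K, (a i : EReal) * elog (eval x (p i)) ≤ ((γ i : ℝ) : EReal))
    {ε : ℝ} (hε : 0 < ε) :
    ∀ᶠ k in atTop, fMomK a p (c '' ↑E) (c '' ↑I) k ≤ ((∑ i, γ i + m * ε : ℝ) : EReal) := by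
  subst hK
  have key : ∀ i, EventuallyNonneg (c '' ↑E) (c '' ↑I) (C (Real.exp ((γ i + ε) / a i)) - p i) := by
    refine fun i => .of_mem_idealQM (mem_idealQM_of_pos hArch fun x hE hI => ?_)
    have h1 := le_exp_of_mul_elog_le (ha i) (hγ i x ⟨hE, hI⟩)
    have h2 : Real.exp (γ i / a i) < Real.exp ((γ i + ε) / a i) :=
      Real.exp_lt_exp.2 (div_lt_div_of_pos_right (by linarith) (ha i))
    simp only [map_sub, eval_C]
    linarith
  filter_upwards [eventually_all.2 key] with k hk
  refine sSup_le ?_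
  rintro _ ⟨y, hy, rfl⟩
  have hs : ∑ i, γ i + m * ε = ∑ i, (γ i + ε) := by simp [Finset.sum_add_distrib]
  rw [hs, coe_sum_ereal]
  refine Finset.sum_le_sum fun i _ => mul_elog_le (ha i) ?_
  have h1 := hk i y hy
  rw [map_sub, ← monomial_zero', riesz_monomial, hy.1] at h1
  rw [pairing_eq_riesz]
  linarith

end Bounds

/-- **Theorem 3.4.**  If `Ideal[c_E] + QM[c_I]` is Archimedean,
`K ≠ ∅`, and `f_mom = f_γ` with the infimum defining `f_γ` attained, then
`f_mom,k → f_mom` as `k → ∞`; more precisely, for every `ε > 0` there is `N`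
with `f_mom ≤ f_mom,k ≤ f_mom + m·ε` for all `k ≥ N`. -/
theorem fMomK_tendsto_fMom
    {n m : ℕ} (hm : 1 ≤ m) {ι : Type*} [DecidableEq ι]
    (E I : Finset ι) (hEI : Disjoint E I)
    (c : ι → MvPolynomial (Fin n) ℝ)
    (K : Set (Fin n → ℝ))
    (hK : K = {x | (∀ j ∈ E, eval x (c j) = 0) ∧ ∀ j ∈ I, 0 ≤ eval x (c j)})
    (hKne : K.Nonempty)
    (a : Fin m → ℝ) (ha : ∀ i, 0 < a i)
    (p : Fin m → MvPolynomial (Fin n) ℝ)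
    (hp : ∀ i, ∀ x ∈ K, 0 ≤ eval x (p i))
    (d : ℕ)
    (hd : d = (Finset.univ.sup fun i => ceilHalf (p i).totalDegree) ⊔
      ((E ∪ I).sup fun j => ceilHalf (c j).totalDegree))
    (hArch : ∃ q ∈ idealQM E I c, IsCompact {x : Fin n → ℝ | 0 ≤ eval x q})
    (heq : fMom d a p K = fGamma a p K)
    (hattain : ∃ γ : Fin m → ℝ,
      (∀ i, ∀ x ∈ K, (a i : EReal) * elog (eval x (p i)) ≤ ((γ i : ℝ) : EReal)) ∧
      ((∑ i, γ i : ℝ) : EReal) = fGamma a p K) :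
    Tendsto (fun k => fMomK a p (c '' ↑E) (c '' ↑I) k) atTop (𝓝 (fMom d a p K)) ∧
    ∀ ε : ℝ, 0 < ε → ∃ N : ℕ, ∀ k, N ≤ k →
      fMom d a p K ≤ fMomK a p (c '' ↑E) (c '' ↑I) k ∧
      fMomK a p (c '' ↑E) (c '' ↑I) k ≤ fMom d a p K + (m : EReal) * (ε : EReal) := by
  obtain ⟨γ, hγ, hG⟩ := hattain
  have hF : fMom d a p K = ((∑ i, γ i : ℝ) : EReal) := heq.trans hG.symm
  have hdeg : ∀ i, (p i).totalDegree ≤ 2 * d := fun i => by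
    have h : ceilHalf (p i).totalDegree ≤ d := by
      rw [hd]
      exact (Finset.le_sup (f := fun i => ceilHalf (p i).totalDegree) (mem_univ i)).trans
        le_sup_left
    unfold ceilHalf at h
    omega
  have hlow := fMom_le_fMomK hK a p hdeg
  have hup := fun ε (hε : (0 : ℝ) < ε) => eventually_fMomK_le hK ha hArch hγ hε
  refine ⟨?_, fun ε hε => ?_⟩
  · refine tendsto_order.2 ⟨fun b hb => .of_forall fun k => hb.trans_le (hlow k), fun b hb => ?_⟩
    rw [hF] at hb
    obtain ⟨r, hr, hrb⟩ := EReal.lt_iff_exists_real_btwn.1 hb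
    rw [EReal.coe_lt_coe_iff] at hr
    have hm0 : (0 : ℝ) < m := by exact_mod_cast hm
    filter_upwards [hup ((r - ∑ i, γ i) / m) (div_pos (sub_pos.2 hr) hm0)] with k hk
    rw [mul_div_cancel₀ _ hm0.ne', add_sub_cancel] at hk
    exact hk.trans_lt hrb
  · obtain ⟨N, hN⟩ := eventually_atTop.1 (hup ε hε)
    refine ⟨N, fun k hk => ⟨hlow k, (hN k hk).trans_eq ?_⟩⟩
    rw [hF, EReal.coe_add, EReal.coe_mul, EReal.coe_natCast]

end
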